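/- Let (L, Φ) be a left B-coquasi-bialgebroid, and let Σ be a unital convolution-invertible element of the B-bimodule maps L ⊗_{B^e} L → B such that Σ(X, Y t(b)) = Σ(X, Y s(b)) for all X,Y ∈ L, b ∈ B. Then the underlying B-coring of L with the new product X ·_Σ Y := s(Σ(X₍₁₎,Y₍₁₎)) t(Σ⁻¹(X₍₃₎,Y₍₃₎)) X₍₂₎Y₍₂₎ is a left B-coquasi-bialgebroid L^Σ, whose 3-cocycle is Φ^Σ(X,Y,Z) = Σ(X₍₁₎, s(Σ(Y₍₁₎,Z₍₁₎)) Y₍₂₎Z₍₂₎) Φ(X₍₂₎, Y₍₃₎, Z₍₃₎) Σ⁻¹(t(Σ⁻¹(X₍₄₎,Y₍₅₎)) X₍₃₎Y₍₄₎, Z₍₄₎). -/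

import Mathlib

open scoped TensorProduct
open TensorProduct

noncomputable section
attribute [local instance] Classical.propDecidable

/-- Choice-based lift of a (bilinear) function to the tensor product: if a linear map agreeing
with `f` on pure tensors exists, this is it (it is then unique); otherwise `0`. -/
def tlift (R : Type*) [CommRing R] {M N Q : Type*} [AddCommGroup M] [Module R M]
    [AddCommGroup N] [Module R N] [AddCommGroup Q] [Module R Q]
    (f : M → N → Q) : M ⊗[R] N →ₗ[R] Q :=
  if h : ∃ F : M ⊗[R] N →ₗ[R] Q, ∀ x y, F (x ⊗ₜ[R] y) = f x y then h.choose else 0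

/-- Choice-based lift of a (bilinear, balanced) function to a quotient of the tensor product. -/
def qtlift (R : Type*) [CommRing R] {M N Q : Type*} [AddCommGroup M] [Module R M]
    [AddCommGroup N] [Module R N] [AddCommGroup Q] [Module R Q]
    (p : Submodule R (M ⊗[R] N)) (f : M → N → Q) : ((M ⊗[R] N) ⧸ p) →ₗ[R] Q :=
  if h : ∃ F : ((M ⊗[R] N) ⧸ p) →ₗ[R] Q,
      ∀ x y, F (Submodule.Quotient.mk (x ⊗ₜ[R] y)) = f x y then h.choose else 0

variable (k : Type*) [Field k]

/-- The data of a left coquasi-bialgebroid: a (not necessarily associative) product with unit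
on a `k`-module `L` and source/target maps from `B`. -/
structure CqST (B L : Type*) [Ring B] [Algebra k B] [AddCommGroup L] [Module k L] where
  mul : L →ₗ[k] L →ₗ[k] L
  one : L
  s : B →ₗ[k] L
  t : B →ₗ[k] L

namespace CqST

variable {k} {B L : Type*} [Ring B] [Algebra k B] [AddCommGroup L] [Module k L]
variable (d : CqST k B L)

/-- The relations defining `L ⊗_B L`: `t a · X ⊗ Y ~ X ⊗ s a · Y`. -/
def rel : Submodule k (L ⊗[k] L) :=
  Submodule.span k {z | ∃ (a : B) (X Y : L),
    z = (d.mul (d.t a) X) ⊗ₜ[k] Y - X ⊗ₜ[k] (d.mul (d.s a) Y)}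

/-- `L ⊗_B L`. -/
abbrev T2 := (L ⊗[k] L) ⧸ d.rel

def mk2 (X Y : L) : d.T2 := Submodule.Quotient.mk (X ⊗ₜ[k] Y)

def lift2 {Q : Type*} [AddCommGroup Q] [Module k Q] (f : L → L → Q) : d.T2 →ₗ[k] Q :=
  qtlift k d.rel f

/-- Relations for the triple tensor `L ⊗_B L ⊗_B L`. -/
def rel3 : Submodule k (L ⊗[k] (L ⊗[k] L)) :=
  Submodule.span k
    ({z | ∃ (a : B) (X Y Z : L),
        z = (d.mul (d.t a) X) ⊗ₜ[k] (Y ⊗ₜ[k] Z) - X ⊗ₜ[k] ((d.mul (d.s a) Y) ⊗ₜ[k] Z)} ∪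
     {z | ∃ (a : B) (X Y Z : L),
        z = X ⊗ₜ[k] ((d.mul (d.t a) Y) ⊗ₜ[k] Z) - X ⊗ₜ[k] (Y ⊗ₜ[k] (d.mul (d.s a) Z))})

abbrev T3 := (L ⊗[k] (L ⊗[k] L)) ⧸ d.rel3

def mk3 (X Y Z : L) : d.T3 := Submodule.Quotient.mk (X ⊗ₜ[k] (Y ⊗ₜ[k] Z))

/-- The factorwise product (with respect to a product `p` on `L`) of two elements of
`L ⊗_B L`, when well defined on representatives; junk value `0` otherwise. -/
def mulT2P (p : L → L → L) (z w : d.T2) : d.T2 :=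
  if h : ∃ u : d.T2, ∀ zr wr : L ⊗[k] L, Submodule.Quotient.mk zr = z →
      Submodule.Quotient.mk wr = w →
      Submodule.Quotient.mk
        ((tlift k (fun x1 x2 => (tlift k (fun y1 y2 => (p x1 y1) ⊗ₜ[k] (p x2 y2))) wr)) zr) = u
  then h.choose else 0

/-- Convolution of `B`-valued forms on `L ⊗_{B^e} L`. -/
def conv2P (cop : L →ₗ[k] d.T2) (f g : L → L → B) (X Y : L) : B :=
  d.lift2 (fun y1 y2 => d.lift2 (fun x1 x2 => f x1 y1 * g x2 y2) (cop X)) (cop Y)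

/-- Convolution of `B`-valued forms on `L ⊗_{B^e} L ⊗_{B^e} L`. -/
def conv3P (cop : L →ₗ[k] d.T2) (f g : L → L → L → B) (X Y Z : L) : B :=
  d.lift2 (fun z1 z2 => d.lift2 (fun y1 y2 =>
    d.lift2 (fun x1 x2 => f x1 y1 z1 * g x2 y2 z2) (cop X)) (cop Y)) (cop Z)

/-- The axioms of a left `B`-coquasi-bialgebroid with product `p`, coproduct `cop`, counit
`cou` and invertible normalised 3-cocycle `(Φ, Φi)` (Definition 4.1 of the paper). -/
def IsCoquasi (p : L → L → L) (cop : L →ₗ[k] d.T2) (cou : L →ₗ[k] B)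
    (Φ Φi : L → L → L → B) : Prop :=
  (∃ p' : L →ₗ[k] L →ₗ[k] L, ∀ X Y, p' X Y = p X Y) ∧
  (∀ X : L, p d.one X = X ∧ p X d.one = X) ∧
  (∀ a b : B, p (d.s a) (d.s b) = d.s (a * b)) ∧ d.s 1 = d.one ∧
  (∀ a b : B, p (d.t a) (d.t b) = d.t (b * a)) ∧ d.t 1 = d.one ∧
  (∀ a b : B, p (d.s a) (d.t b) = p (d.t b) (d.s a)) ∧
  -- the coring structure
  (∀ X : L, d.lift2 (fun x1 x2 => d.lift2 (fun y1 y2 => d.mk3 x1 y1 y2) (cop x2)) (cop X) =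
    d.lift2 (fun x12 x3 => d.lift2 (fun x1 x2 => d.mk3 x1 x2 x3) (cop x12)) (cop X)) ∧
  (∀ X : L, d.lift2 (fun x1 x2 => p (d.s (cou x1)) x2) (cop X) = X) ∧
  (∀ X : L, d.lift2 (fun x1 x2 => p (d.t (cou x2)) x1) (cop X) = X) ∧
  -- the coproduct corestricts to an algebra map into the Takeuchi product
  cop d.one = d.mk2 d.one d.one ∧
  (∀ X Y : L, cop (p X Y) = d.mulT2P p (cop X) (cop Y)) ∧
  (∀ (b : B) (X : L), d.lift2 (fun x y => d.mk2 (p x (d.t b)) y) (cop X) =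
    d.lift2 (fun x y => d.mk2 x (p y (d.s b))) (cop X)) ∧
  (∀ (b : B) (X : L), cop (p (d.s b) X) = d.lift2 (fun x y => d.mk2 (p (d.s b) x) y) (cop X)) ∧
  (∀ (b : B) (X : L), cop (p (d.t b) X) = d.lift2 (fun x y => d.mk2 x (p (d.t b) y)) (cop X)) ∧
  -- the counit is a left character
  cou d.one = 1 ∧
  (∀ (b : B) (X : L), cou (p (d.s b) X) = b * cou X) ∧
  (∀ (b : B) (X : L), cou (p (d.t b) X) = cou X * b) ∧
  (∀ X Y : L, cou (p X (d.s (cou Y))) = cou (p X Y)) ∧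
  (∀ X Y : L, cou (p X (d.t (cou Y))) = cou (p X Y)) ∧
  -- Φ is an invertible normalised 3-cocycle
  (∃ Φ' : L →ₗ[k] L →ₗ[k] L →ₗ[k] B, ∀ X Y Z, Φ' X Y Z = Φ X Y Z) ∧
  (∀ (b c : B) (X Y Z : L), Φ (p (d.s b) (p (d.t c) X)) Y Z = b * Φ X Y Z * c) ∧
  (∀ (b c : B) (X Y Z : L),
    Φ (p (p X (d.s b)) (d.t c)) Y Z = Φ X (p (d.s b) (p (d.t c) Y)) Z) ∧
  (∀ (b c : B) (X Y Z : L),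
    Φ X (p (p Y (d.s b)) (d.t c)) Z = Φ X Y (p (d.s b) (p (d.t c) Z))) ∧
  (∀ X Y : L, Φ d.one X Y = cou (p X Y) ∧ Φ X d.one Y = cou (p X Y)) ∧
  (∀ (b : B) (X Y Z : L), Φ X Y (p Z (d.s b)) = Φ X Y (p Z (d.t b))) ∧
  -- the 3-cocycle condition
  (∀ X Y Z W : L,
    d.lift2 (fun w1 w2 => d.lift2 (fun z1 z2 => d.lift2 (fun y1 y2 => d.lift2 (fun x1 x2 =>
      Φ x1 y1 (p z1 w1) * Φ (p x2 y2) z2 w2) (cop X)) (cop Y)) (cop Z)) (cop W) =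
    d.lift2 (fun w1 w2 => d.lift2 (fun z1 z23 => d.lift2 (fun z2 z3 =>
      d.lift2 (fun y1 y23 => d.lift2 (fun y2 y3 => d.lift2 (fun x1 x2 =>
        Φ x1 (p (d.s (Φ y1 z1 w1)) (p y2 z2)) w2 * Φ x2 y3 z3)
        (cop X)) (cop y23)) (cop Y)) (cop z23)) (cop Z)) (cop W)) ∧
  -- quasi-associativity controlled by Φ
  (∀ X Y Z : L,
    d.lift2 (fun z1 z2 => d.lift2 (fun y1 y2 => d.lift2 (fun x1 x2 =>
      p (d.s (Φ x1 y1 z1)) (p (p x2 y2) z2)) (cop X)) (cop Y)) (cop Z) =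
    d.lift2 (fun z1 z2 => d.lift2 (fun y1 y2 => d.lift2 (fun x1 x2 =>
      p (d.t (Φ x2 y2 z2)) (p x1 (p y1 z1))) (cop X)) (cop Y)) (cop Z)) ∧
  -- invertibility of Φ
  (∃ Φi' : L →ₗ[k] L →ₗ[k] L →ₗ[k] B, ∀ X Y Z, Φi' X Y Z = Φi X Y Z) ∧
  (∀ X Y Z : L, d.conv3P cop Φ Φi X Y Z = cou (p X (p Y Z))) ∧
  (∀ X Y Z : L, d.conv3P cop Φi Φ X Y Z = cou (p X (p Y Z)))

/-- The twisted product `X ·_Σ Y := s(Σ(X₁,Y₁)) t(Σ⁻¹(X₃,Y₃)) X₂Y₂`. -/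
def prodSigma (cop : L →ₗ[k] d.T2) (Sg Sgi : L → L → B) (X Y : L) : L :=
  d.lift2 (fun y1 y23 => d.lift2 (fun y2 y3 => d.lift2 (fun x1 x23 => d.lift2 (fun x2 x3 =>
    d.mul (d.s (Sg x1 y1)) (d.mul (d.t (Sgi x3 y3)) (d.mul x2 y2))) (cop x23)) (cop X))
    (cop y23)) (cop Y)

/-- The twisted 3-cocycle
`Φ^Σ(X,Y,Z) = Σ(X₁, s(Σ(Y₁,Z₁))Y₂Z₂) Φ(X₂,Y₃,Z₃) Σ⁻¹(t(Σ⁻¹(X₄,Y₅)) X₃Y₄, Z₄)`. -/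
def PhiSigma (cop : L →ₗ[k] d.T2) (Sg Sgi : L → L → B) (Φ : L → L → L → B)
    (X Y Z : L) : B :=
  d.lift2 (fun z1 z234 => d.lift2 (fun z2 z34 => d.lift2 (fun z3 z4 =>
    d.lift2 (fun y1 y2345 => d.lift2 (fun y2 y345 => d.lift2 (fun y3 y45 =>
      d.lift2 (fun y4 y5 =>
        d.lift2 (fun x1 x234 => d.lift2 (fun x2 x34 => d.lift2 (fun x3 x4 =>
          Sg x1 (d.mul (d.s (Sg y1 z1)) (d.mul y2 z2)) * Φ x2 y3 z3 *
            Sgi (d.mul (d.t (Sgi x4 y5)) (d.mul x3 y4)) z4)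
          (cop x34)) (cop x234)) (cop X))
      (cop y45)) (cop y345)) (cop y2345)) (cop Y))
    (cop z34)) (cop z234)) (cop Z)

end CqST

namespace CqST

variable {k} {B L : Type*} [Ring B] [Algebra k B] [AddCommGroup L] [Module k L]

section Balanced

variable (d : CqST k B L) {Q Q' : Type*} [AddCommGroup Q] [Module k Q] [AddCommGroup Q']
  [Module k Q']

/-- A function of two variables is balanced if it factors linearly through `L ⊗_B L`. -/
def Bal (f : L → L → Q) : Prop := ∃ F : d.T2 →ₗ[k] Q, ∀ x y, F (d.mk2 x y) = f x y

variable {d}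

lemma T2_ext {F G : d.T2 →ₗ[k] Q} (h : ∀ x y, F (d.mk2 x y) = G (d.mk2 x y)) : F = G := by
  refine Submodule.linearMap_qext _ (TensorProduct.ext' fun x y => h x y)

lemma lift2_eq {f : L → L → Q} (F : d.T2 →ₗ[k] Q) (h : ∀ x y, F (d.mk2 x y) = f x y) :
    d.lift2 f = F := by
  have hex : ∃ F : ((L ⊗[k] L) ⧸ d.rel) →ₗ[k] Q,
      ∀ x y, F (Submodule.Quotient.mk (x ⊗ₜ[k] y)) = f x y := ⟨F, h⟩
  unfold lift2 qtlift
  rw [dif_pos hex]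
  exact T2_ext fun x y => (hex.choose_spec x y).trans (h x y).symm

lemma lift2_of_not_bal {f : L → L → Q} (h : ¬ d.Bal f) : d.lift2 f = 0 := dif_neg h

lemma bal_of_lift2_ne_zero {f : L → L → Q} {z : d.T2} (h : d.lift2 f z ≠ 0) : d.Bal f := by
  by_contra hf
  exact h (by rw [lift2_of_not_bal hf]; rfl)

lemma Bal.lift2_mk2 {f : L → L → Q} (hf : d.Bal f) (x y : L) :
    d.lift2 f (d.mk2 x y) = f x y := by
  obtain ⟨F, hF⟩ := hf
  rw [lift2_eq F hF, hF]

lemma Bal.comp {f : L → L → Q} (hf : d.Bal f) (φ : Q →ₗ[k] Q') : d.Bal fun x y => φ (f x y) := by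
  obtain ⟨F, hF⟩ := hf
  exact ⟨φ ∘ₗ F, fun x y => by simp [hF]⟩

lemma Bal.map_lift2 {f : L → L → Q} (hf : d.Bal f) (φ : Q →ₗ[k] Q') (z : d.T2) :
    φ (d.lift2 f z) = d.lift2 (fun x y => φ (f x y)) z := by
  obtain ⟨F, hF⟩ := hf
  rw [lift2_eq F hF, lift2_eq (φ ∘ₗ F) fun x y => by simp [hF]]
  rfl

lemma Bal.apply_eq {f : L → L → Q} (hf : d.Bal f) (a : B) (x y : L) :
    f (d.mul (d.t a) x) y = f x (d.mul (d.s a) y) := by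
  obtain ⟨F, hF⟩ := hf
  rw [← hF, ← hF]
  congr 1
  exact (Submodule.Quotient.eq _).2 (Submodule.subset_span ⟨a, x, y, rfl⟩)

lemma Bal.exists_linear {f : L → L → Q} (hf : d.Bal f) :
    ∃ f' : L →ₗ[k] L →ₗ[k] Q, ∀ x y, f' x y = f x y := by
  obtain ⟨F, hF⟩ := hf
  exact ⟨(TensorProduct.mk k L L).compr₂ (F ∘ₗ d.rel.mkQ), hF⟩

lemma Bal.of_linear (f : L →ₗ[k] L →ₗ[k] Q)
    (h : ∀ a x y, f (d.mul (d.t a) x) y = f x (d.mul (d.s a) y)) : d.Bal fun x y => f x y := by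
  refine ⟨d.rel.liftQ (TensorProduct.lift f) ?_, fun x y => ?_⟩
  · refine Submodule.span_le.2 ?_
    rintro _ ⟨a, x, y, rfl⟩
    simp [h]
  · exact (Submodule.liftQ_apply _ _ _).trans (TensorProduct.lift.tmul _ _)

lemma bal_mk2 : d.Bal d.mk2 := ⟨LinearMap.id, fun _ _ => rfl⟩

variable (d) in
/-- The canonical bilinear map to `L ⊗_B L`. -/
def mk2L : L →ₗ[k] L →ₗ[k] d.T2 := (TensorProduct.mk k L L).compr₂ d.rel.mkQ

@[simp] lemma mk2L_apply (x y : L) : d.mk2L x y = d.mk2 x y := rfl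

lemma mk2_bal (a : B) (x y : L) :
    d.mk2 (d.mul (d.t a) x) y = d.mk2 x (d.mul (d.s a) y) := bal_mk2.apply_eq a x y

@[simp] lemma lift2_mk2_eq (z : d.T2) : d.lift2 d.mk2 z = z := by
  rw [lift2_eq (f := d.mk2) LinearMap.id fun _ _ => rfl]; rfl

end Balanced

/-- A left bialgebroid whose product need not be associative. -/
structure Good (d : CqST k B L) (cop : L →ₗ[k] d.T2) (cou : L →ₗ[k] B) : Prop where
  one_mul : ∀ X, d.mul d.one X = X
  mul_one : ∀ X, d.mul X d.one = X
  s_one : d.s 1 = d.one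
  t_one : d.t 1 = d.one
  s_s : ∀ a b X, d.mul (d.s a) (d.mul (d.s b) X) = d.mul (d.s (a * b)) X
  t_t : ∀ a b X, d.mul (d.t a) (d.mul (d.t b) X) = d.mul (d.t (b * a)) X
  s_t : ∀ a b X, d.mul (d.s a) (d.mul (d.t b) X) = d.mul (d.t b) (d.mul (d.s a) X)
  s_assoc : ∀ a X Y, d.mul (d.mul (d.s a) X) Y = d.mul (d.s a) (d.mul X Y)
  t_assoc : ∀ a X Y, d.mul (d.mul (d.t a) X) Y = d.mul (d.t a) (d.mul X Y)
  mid_s : ∀ a X Y, d.mul (d.mul X (d.s a)) Y = d.mul X (d.mul (d.s a) Y)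
  mid_t : ∀ a X Y, d.mul (d.mul X (d.t a)) Y = d.mul X (d.mul (d.t a) Y)
  coassoc : ∀ X, d.lift2 (fun x1 x2 => d.lift2 (fun y1 y2 => d.mk3 x1 y1 y2) (cop x2)) (cop X) =
    d.lift2 (fun x12 x3 => d.lift2 (fun x1 x2 => d.mk3 x1 x2 x3) (cop x12)) (cop X)
  cou_s : ∀ X, d.lift2 (fun x1 x2 => d.mul (d.s (cou x1)) x2) (cop X) = X
  cou_t : ∀ X, d.lift2 (fun x1 x2 => d.mul (d.t (cou x2)) x1) (cop X) = X
  cop_one : cop d.one = d.mk2 d.one d.one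
  cop_mul : ∀ X Y, cop (d.mul X Y) = d.lift2 (fun y1 y2 => d.lift2 (fun x1 x2 =>
    d.mk2 (d.mul x1 y1) (d.mul x2 y2)) (cop X)) (cop Y)
  takeuchi : ∀ b X, d.lift2 (fun x y => d.mk2 (d.mul x (d.t b)) y) (cop X) =
    d.lift2 (fun x y => d.mk2 x (d.mul y (d.s b))) (cop X)
  cop_s : ∀ b X, cop (d.mul (d.s b) X) = d.lift2 (fun x y => d.mk2 (d.mul (d.s b) x) y) (cop X)
  cop_t : ∀ b X, cop (d.mul (d.t b) X) = d.lift2 (fun x y => d.mk2 x (d.mul (d.t b) y)) (cop X)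
  cou_one : cou d.one = 1
  cou_s_mul : ∀ b X, cou (d.mul (d.s b) X) = b * cou X
  cou_t_mul : ∀ b X, cou (d.mul (d.t b) X) = cou X * b
  cou_mul_s : ∀ X Y, cou (d.mul X (d.s (cou Y))) = cou (d.mul X Y)
  cou_mul_t : ∀ X Y, cou (d.mul X (d.t (cou Y))) = cou (d.mul X Y)

/-- An algebra `A` with an algebra map from `B`. -/
class BRing (k B A : Type*) [Field k] [Ring B] [Algebra k B] [Ring A] [Algebra k A] where
  /-- The structure map. -/
  u : B →ₐ[k] A

/-- The structure map of a `B`-ring. -/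
def u (k : Type*) {B A : Type*} [Field k] [Ring B] [Algebra k B] [Ring A] [Algebra k A]
    [BRing k B A] : B →ₐ[k] A := BRing.u

instance : BRing k B B := ⟨AlgHom.id k B⟩

@[simp] lemma u_self (b : B) : (u k b : B) = b := rfl

variable {d : CqST k B L} {cop : L →ₗ[k] d.T2} {cou : L →ₗ[k] B}

/-- The submodule of `B`-bimodule maps `L → A`. -/
def convSub (d : CqST k B L) (A : Type*) [Ring A] [Algebra k A] [BRing k B A] :
    Submodule k (L →ₗ[k] A) where
  carrier := {F | (∀ b X, F (d.mul (d.s b) X) = u k b * F X) ∧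
    ∀ b X, F (d.mul (d.t b) X) = F X * u k b}
  add_mem' := by
    rintro F G ⟨h1, h2⟩ ⟨h3, h4⟩
    exact ⟨fun b X => by simp [h1, h3, mul_add], fun b X => by simp [h2, h4, add_mul]⟩
  zero_mem' := by simp
  smul_mem' := by
    rintro c F ⟨h1, h2⟩
    exact ⟨fun b X => by simp [h1], fun b X => by simp [h2]⟩

/-- The convolution algebra of `B`-bimodule maps `L → A`. -/
def Conv (_ : Good d cop cou) (A : Type*) [Ring A] [Algebra k A] [BRing k B A] : Type _ :=
  convSub d A

namespace Conv

variable {h : Good d cop cou} {A : Type*} [Ring A] [Algebra k A] [BRing k B A]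

instance : AddCommGroup (Conv h A) := inferInstanceAs (AddCommGroup (convSub d A))
instance : Module k (Conv h A) := inferInstanceAs (Module k (convSub d A))

instance : FunLike (Conv h A) L A where
  coe F := F.1
  coe_injective _ _ hFG := Subtype.ext (DFunLike.coe_injective hFG)

instance : LinearMapClass (Conv h A) k L A where
  map_add F := F.1.map_add
  map_smulₛₗ F := F.1.map_smul

@[ext] lemma ext {F G : Conv h A} (H : ∀ X, F X = G X) : F = G := DFunLike.ext _ _ H

/-- Construct an element of the convolution algebra. -/
def mk (F : L →ₗ[k] A) (hs : ∀ b X, F (d.mul (d.s b) X) = u k b * F X)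
    (ht : ∀ b X, F (d.mul (d.t b) X) = F X * u k b) : Conv h A := ⟨F, hs, ht⟩

@[simp] lemma mk_apply (F : L →ₗ[k] A) (hs ht) (X : L) : (mk F hs ht : Conv h A) X = F X := id rfl

/-- The underlying linear map. -/
def lin (F : Conv h A) : L →ₗ[k] A := F.1

@[simp] lemma lin_apply (F : Conv h A) (X : L) : F.lin X = F X := id rfl

lemma map_s (F : Conv h A) (b : B) (X : L) : F (d.mul (d.s b) X) = u k b * F X := F.2.1 b X

lemma map_t (F : Conv h A) (b : B) (X : L) : F (d.mul (d.t b) X) = F X * u k b := F.2.2 b X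

@[simp] lemma add_apply (F G : Conv h A) (X : L) : (F + G) X = F X + G X := id rfl
@[simp] lemma smul_apply (c : k) (F : Conv h A) (X : L) : (c • F) X = c • F X := id rfl
@[simp] lemma zero_apply (X : L) : (0 : Conv h A) X = 0 := id rfl

/-- Evaluation as a linear map. -/
def ev (X : L) : Conv h A →ₗ[k] A where
  toFun F := F X
  map_add' _ _ := rfl
  map_smul' _ _ := rfl

@[simp] lemma ev_apply (X : L) (F : Conv h A) : ev X F = F X := id rfl

lemma bal (F G : Conv h A) : d.Bal fun x y => F x * G y :=
  Bal.of_linear ((LinearMap.mul k A).compl₁₂ F.lin G.lin) fun a x y => by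
    simp [map_s, map_t, mul_assoc]

lemma bal_s_left (h : Good d cop cou) (b : B) : d.Bal fun x y => d.mk2 (d.mul (d.s b) x) y :=
  Bal.of_linear (d.mk2L ∘ₗ d.mul (d.s b)) fun a x y => by
    simp [h.s_t, mk2_bal]

lemma bal_t_right (h : Good d cop cou) (b : B) : d.Bal fun x y => d.mk2 x (d.mul (d.t b) y) :=
  Bal.of_linear (d.mk2L.compl₂ (d.mul (d.t b))) fun a x y => by
    simp [← h.s_t, mk2_bal]

lemma bal_mul_t (h : Good d cop cou) (b : B) : d.Bal fun x y => d.mk2 (d.mul x (d.t b)) y :=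
  Bal.of_linear (d.mk2L ∘ₗ d.mul.flip (d.t b)) fun a x y => by
    simp [h.t_assoc, mk2_bal]

lemma bal_mul_s (h : Good d cop cou) (b : B) : d.Bal fun x y => d.mk2 x (d.mul y (d.s b)) :=
  Bal.of_linear (d.mk2L.compl₂ (d.mul.flip (d.s b))) fun a x y => by
    simp [h.s_assoc, mk2_bal]

lemma bal_cou_s (h : Good d cop cou) : d.Bal fun x y => d.mul (d.s (cou x)) y :=
  Bal.of_linear (d.mul ∘ₗ d.s ∘ₗ cou) fun a x y => by
    simp [h.cou_t_mul, h.s_s]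

lemma bal_cou_t (h : Good d cop cou) : d.Bal fun x y => d.mul (d.t (cou y)) x :=
  Bal.of_linear (d.mul ∘ₗ d.t ∘ₗ cou).flip fun a x y => by
    simp [h.cou_s_mul, h.t_t]

instance : Mul (Conv h A) where
  mul F G := mk (d.lift2 (fun x y => F x * G y) ∘ₗ cop)
    (fun b X => by
      simp only [LinearMap.comp_apply, h.cop_s]
      rw [(bal_s_left h b).map_lift2]
      simp only [(bal F G).lift2_mk2, map_s, mul_assoc]
      exact ((bal F G).map_lift2 (LinearMap.mulLeft k (u k b : A)) _).symm)
    (fun b X => by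
      simp only [LinearMap.comp_apply, h.cop_t]
      rw [(bal_t_right h b).map_lift2]
      simp only [(bal F G).lift2_mk2, map_t, ← mul_assoc]
      exact ((bal F G).map_lift2 (LinearMap.mulRight k (u k b : A)) _).symm)

lemma mul_apply (F G : Conv h A) (X : L) :
    (F * G) X = d.lift2 (fun x y => F x * G y) (cop X) := rfl

instance : One (Conv h A) where
  one := mk ((u k : B →ₐ[k] A).toLinearMap ∘ₗ cou) (fun b X => by simp [h.cou_s_mul])
    (fun b X => by simp [h.cou_t_mul])

lemma one_apply (X : L) : (1 : Conv h A) X = u k (cou X) := rfl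

lemma map_mul_apply {Q : Type*} [AddCommGroup Q] [Module k Q] (φ : A →ₗ[k] Q) (F G : Conv h A)
    (X : L) : φ ((F * G) X) = d.lift2 (fun x y => φ (F x * G y)) (cop X) :=
  (bal F G).map_lift2 φ _

/-- The map on `L ⊗_B L ⊗_B L` induced by three elements of the convolution algebra. -/
def mul3 (F G H : Conv h A) : d.T3 →ₗ[k] A :=
  d.rel3.liftQ (TensorProduct.lift (((LinearMap.mul k A).compl₁₂ F.lin
    (TensorProduct.lift ((LinearMap.mul k A).compl₁₂ G.lin H.lin))))) (by
      refine Submodule.span_le.2 ?_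
      rintro _ (⟨a, x, y, z, rfl⟩ | ⟨a, x, y, z, rfl⟩) <;>
      simp [map_s, map_t, mul_assoc])

lemma mul3_mk3 (F G H : Conv h A) (x y z : L) :
    mul3 F G H (d.mk3 x y z) = F x * (G y * H z) :=
  (Submodule.liftQ_apply _ _ _).trans (by simp)

lemma _root_.CqST.bal_mk3_left (x : L) : d.Bal fun y z => d.mk3 x y z :=
  Bal.of_linear ((TensorProduct.mk k L L).compr₂ (d.rel3.mkQ ∘ₗ TensorProduct.mk k L (L ⊗[k] L) x))
    fun a y z => (Submodule.Quotient.eq _).2 (Submodule.subset_span (Or.inr ⟨a, x, y, z, rfl⟩))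

lemma _root_.CqST.bal_mk3_right (z : L) : d.Bal fun x y => d.mk3 x y z :=
  Bal.of_linear ((((TensorProduct.mk k L (L ⊗[k] L)).compl₂
    ((TensorProduct.mk k L L).flip z)).compr₂ d.rel3.mkQ))
    fun a x y => (Submodule.Quotient.eq _).2 (Submodule.subset_span (Or.inl ⟨a, x, y, z, rfl⟩))


lemma lift2_mk3_s (h : Good d cop cou) (a : B) (x y : L) :
    d.lift2 (fun y1 y2 => d.mk3 (d.mul (d.t a) x) y1 y2) (cop y) =
      d.lift2 (fun y1 y2 => d.mk3 x y1 y2) (cop (d.mul (d.s a) y)) := by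
  rw [h.cop_s, (bal_s_left h a).map_lift2]
  simp only [(bal_mk3_left x).lift2_mk2]
  congr 2
  ext y1 y2
  exact (bal_mk3_right y2).apply_eq a x y1

lemma lift2_mk3_t (h : Good d cop cou) (a : B) (x z : L) :
    d.lift2 (fun y1 y2 => d.mk3 y1 y2 z) (cop (d.mul (d.t a) x)) =
      d.lift2 (fun y1 y2 => d.mk3 y1 y2 (d.mul (d.s a) z)) (cop x) := by
  rw [h.cop_t, (bal_t_right h a).map_lift2]
  simp only [(bal_mk3_right z).lift2_mk2]
  congr 2
  ext y1 y2
  exact (bal_mk3_left y1).apply_eq a y2 z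

lemma mul3_left (F G H : Conv h A) (x y : L) :
    mul3 F G H (d.lift2 (fun y1 y2 => d.mk3 x y1 y2) (cop y)) = F x * (G * H) y := by
  rw [(bal_mk3_left x).map_lift2]
  simp only [mul3_mk3]
  exact (map_mul_apply (LinearMap.mulLeft k (F x)) G H y).symm

lemma mul3_right (F G H : Conv h A) (x y : L) :
    mul3 F G H (d.lift2 (fun x1 x2 => d.mk3 x1 x2 y) (cop x)) = (F * G) x * H y := by
  rw [(bal_mk3_right y).map_lift2]
  simp only [mul3_mk3, ← mul_assoc]
  exact (map_mul_apply (LinearMap.mulRight k (H y)) F G x).symm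

/-- The canonical map `L → Hom(L ⊗_B L, L ⊗_B L ⊗_B L)` inserting the first tensor factor. -/
def insertLeft (d : CqST k B L) : L →ₗ[k] d.T2 →ₗ[k] d.T3 where
  toFun x := d.lift2 fun y z => d.mk3 x y z
  map_add' x x' := T2_ext fun y z => by
    rw [LinearMap.add_apply]
    simp only [(bal_mk3_left _).lift2_mk2]
    exact congrArg d.rel3.mkQ (TensorProduct.add_tmul _ _ _)
  map_smul' c x := T2_ext fun y z => by
    rw [LinearMap.smul_apply]
    simp only [(bal_mk3_left _).lift2_mk2]
    rfl

/-- The canonical map `L → Hom(L ⊗_B L, L ⊗_B L ⊗_B L)` inserting the last tensor factor. -/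
def insertRight (d : CqST k B L) : L →ₗ[k] d.T2 →ₗ[k] d.T3 where
  toFun z := d.lift2 fun x y => d.mk3 x y z
  map_add' z z' := T2_ext fun x y => by
    rw [LinearMap.add_apply]
    simp only [(bal_mk3_right _).lift2_mk2]
    exact congrArg d.rel3.mkQ (by rw [TensorProduct.tmul_add, TensorProduct.tmul_add])
  map_smul' c z := T2_ext fun x y => by
    rw [LinearMap.smul_apply]
    simp only [(bal_mk3_right _).lift2_mk2]
    exact congrArg d.rel3.mkQ (by simp)

lemma mul_assoc' (F G H : Conv h A) : F * G * H = F * (G * H) := by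
  ext X
  have b1 : d.Bal fun x1 x2 => d.lift2 (fun y1 y2 => d.mk3 x1 y1 y2) (cop x2) :=
    Bal.of_linear ((insertLeft d).compl₂ cop) fun a x y => lift2_mk3_s h a x y
  have b2 : d.Bal fun x12 x3 => d.lift2 (fun x1 x2 => d.mk3 x1 x2 x3) (cop x12) :=
    Bal.of_linear ((insertRight d).compl₂ cop).flip fun a x y => lift2_mk3_t h a x y
  have e := congrArg (mul3 F G H) (h.coassoc X)
  rw [b1.map_lift2, b2.map_lift2] at e
  simp only [mul3_left, mul3_right] at e
  exact e.symm

lemma one_mul' (F : Conv h A) : 1 * F = F := by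
  ext X
  rw [mul_apply]
  simp only [one_apply, ← map_s]
  exact ((bal_cou_s h).map_lift2 F.lin _).symm.trans (congrArg F (h.cou_s X))

lemma mul_one' (F : Conv h A) : F * 1 = F := by
  ext X
  rw [mul_apply]
  simp only [one_apply, ← map_t]
  exact ((bal_cou_t h).map_lift2 F.lin _).symm.trans (congrArg F (h.cou_t X))

lemma mul_add' (F G H : Conv h A) : F * (G + H) = F * G + F * H := by
  ext X
  simp only [mul_apply, add_apply]
  rw [← LinearMap.add_apply]
  congr 1
  refine T2_ext fun x y => ?_
  rw [LinearMap.add_apply]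
  simp only [← add_apply, (bal _ _).lift2_mk2]
  simp [mul_add]

lemma add_mul' (F G H : Conv h A) : (F + G) * H = F * H + G * H := by
  ext X
  simp only [mul_apply, add_apply]
  rw [← LinearMap.add_apply]
  congr 1
  refine T2_ext fun x y => ?_
  rw [LinearMap.add_apply]
  simp only [← add_apply, (bal _ _).lift2_mk2]
  simp [add_mul]

instance : Ring (Conv h A) where
  __ := (inferInstance : AddCommGroup (Conv h A))
  mul_assoc := mul_assoc'
  one_mul := one_mul'
  mul_one := mul_one'
  left_distrib := mul_add'
  right_distrib := add_mul'
  zero_mul F := by simpa using add_mul' 0 0 F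
  mul_zero F := by simpa using mul_add' F 0 0

instance : Algebra k (Conv h A) :=
  Algebra.ofModule
    (fun c F G => by
      ext X
      simp only [mul_apply, smul_apply]
      rw [← LinearMap.smul_apply]
      congr 1
      refine T2_ext fun x y => ?_
      rw [LinearMap.smul_apply]
      simp only [← smul_apply, (bal _ _).lift2_mk2]
      simp)
    (fun c F G => by
      ext X
      simp only [mul_apply, smul_apply]
      rw [← LinearMap.smul_apply]
      congr 1
      refine T2_ext fun x y => ?_
      rw [LinearMap.smul_apply]
      simp only [← smul_apply, (bal _ _).lift2_mk2]
      simp)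

end Conv

lemma bal_mul_mul (h : Good d cop cou) (y1 y2 : L) :
    d.Bal fun x1 x2 => d.mk2 (d.mul x1 y1) (d.mul x2 y2) :=
  Bal.of_linear (d.mk2L.compl₁₂ (d.mul.flip y1) (d.mul.flip y2)) fun a x y => by
    simp [h.t_assoc, h.s_assoc, mk2_bal]

/-- The factorwise right multiplication on `L ⊗_B L`. -/
def mulR (h : Good d cop cou) : L →ₗ[k] L →ₗ[k] d.T2 →ₗ[k] d.T2 :=
  LinearMap.mk₂ k (fun y1 y2 => d.lift2 fun x1 x2 => d.mk2 (d.mul x1 y1) (d.mul x2 y2))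
    (fun y y' z => T2_ext fun x1 x2 => by
      rw [LinearMap.add_apply]
      simp only [(bal_mul_mul h _ _).lift2_mk2]
      simp only [← mk2L_apply, map_add, LinearMap.add_apply])
    (fun c y z => T2_ext fun x1 x2 => by
      rw [LinearMap.smul_apply]
      simp only [(bal_mul_mul h _ _).lift2_mk2]
      simp only [← mk2L_apply, map_smul, LinearMap.smul_apply])
    (fun y z z' => T2_ext fun x1 x2 => by
      rw [LinearMap.add_apply]
      simp only [(bal_mul_mul h _ _).lift2_mk2]
      simp only [← mk2L_apply, map_add])
    (fun c y z => T2_ext fun x1 x2 => by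
      rw [LinearMap.smul_apply]
      simp only [(bal_mul_mul h _ _).lift2_mk2]
      simp only [← mk2L_apply, map_smul])

lemma mulR_apply (h : Good d cop cou) (y1 y2 : L) (z : d.T2) :
    mulR h y1 y2 z = d.lift2 (fun x1 x2 => d.mk2 (d.mul x1 y1) (d.mul x2 y2)) z := rfl

lemma mulR_mk2 (h : Good d cop cou) (x1 x2 y1 y2 : L) :
    mulR h y1 y2 (d.mk2 x1 x2) = d.mk2 (d.mul x1 y1) (d.mul x2 y2) :=
  (bal_mul_mul h y1 y2).lift2_mk2 x1 x2

lemma bal_mulR (h : Good d cop cou) (X : L) : d.Bal fun y1 y2 => mulR h y1 y2 (cop X) :=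
  Bal.of_linear ((mulR h).compr₂ (LinearMap.applyₗ (cop X))) fun a y1 y2 => by
    have e := congrArg (mulR h y1 y2) (h.takeuchi a X)
    rw [(Conv.bal_mul_t h a).map_lift2, (Conv.bal_mul_s h a).map_lift2] at e
    simp only [mulR_mk2, h.mid_s, h.mid_t] at e
    exact e

lemma Good.cop_mul' (h : Good d cop cou) (X Y : L) :
    cop (d.mul X Y) = d.lift2 (fun y1 y2 => mulR h y1 y2 (cop X)) (cop Y) := h.cop_mul X Y

lemma Good.cop_mul_s (h : Good d cop cou) (b : B) (X : L) :
    cop (d.mul X (d.s b)) = d.lift2 (fun x y => d.mk2 (d.mul x (d.s b)) y) (cop X) := by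
  have e : cop (d.s b) = d.mk2 (d.s b) d.one := by
    have := h.cop_s b d.one
    rwa [h.mul_one, h.cop_one, (Conv.bal_s_left h b).lift2_mk2, h.mul_one] at this
  rw [h.cop_mul', e, (bal_mulR h X).lift2_mk2, mulR_apply]
  simp only [h.mul_one]

lemma Good.cop_mul_t (h : Good d cop cou) (b : B) (X : L) :
    cop (d.mul X (d.t b)) = d.lift2 (fun x y => d.mk2 x (d.mul y (d.t b))) (cop X) := by
  have e : cop (d.t b) = d.mk2 d.one (d.t b) := by
    have := h.cop_t b d.one
    rwa [h.mul_one, h.cop_one, (Conv.bal_t_right h b).lift2_mk2, h.mul_one] at this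
  rw [h.cop_mul', e, (bal_mulR h X).lift2_mk2, mulR_apply]
  simp only [h.mul_one]

end CqST

namespace CqST

variable {k} {B L : Type*} [Ring B] [Algebra k B] [AddCommGroup L] [Module k L]
variable {d : CqST k B L} {cop : L →ₗ[k] d.T2} {cou : L →ₗ[k] B}

lemma Good.s_mul (h : Good d cop cou) (a b : B) : d.mul (d.s a) (d.s b) = d.s (a * b) := by
  simpa [h.mul_one] using h.s_s a b d.one

lemma Good.cou_s_self (h : Good d cop cou) (a : B) : cou (d.s a) = a := by
  simpa [h.mul_one, h.cou_one] using h.cou_s_mul a d.one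

lemma Good.cou_mul_t_eq (h : Good d cop cou) (a : B) (X : L) :
    cou (d.mul X (d.t a)) = cou (d.mul X (d.s a)) := by
  simpa [h.cou_s_self] using h.cou_mul_t X (d.s a)

namespace Conv

variable {h : Good d cop cou} {A A' : Type*} [Ring A] [Algebra k A] [BRing k B A]
  [Ring A'] [Algebra k A'] [BRing k B A']

/-- The image of `b` under the structure map of the convolution algebra. -/
def uElt (h : Good d cop cou) (A : Type*) [Ring A] [Algebra k A] [BRing k B A] (b : B) :
    Conv h A :=
  mk ((u k : B →ₐ[k] A).toLinearMap ∘ₗ cou ∘ₗ d.mul.flip (d.s b))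
    (fun a X => by simp [h.s_assoc, h.cou_s_mul])
    (fun a X => by simp [h.t_assoc, h.cou_t_mul])

lemma uElt_apply (b : B) (X : L) : uElt h A b X = u k (cou (d.mul X (d.s b))) := rfl

lemma bal_mul_s_left (h : Good d cop cou) (b : B) :
    d.Bal fun x y => d.mk2 (d.mul x (d.s b)) y :=
  Bal.of_linear (d.mk2L ∘ₗ d.mul.flip (d.s b)) fun a x y => by
    simp [h.t_assoc, mk2_bal]

lemma bal_mul_t_right (h : Good d cop cou) (b : B) :
    d.Bal fun x y => d.mk2 x (d.mul y (d.t b)) :=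
  Bal.of_linear (d.mk2L.compl₂ (d.mul.flip (d.t b))) fun a x y => by
    simp [h.s_assoc, mk2_bal]

lemma uElt_mul (b : B) (F : Conv h A) (X : L) : (uElt h A b * F) X = F (d.mul X (d.s b)) := by
  conv_rhs => rw [← one_mul F, mul_apply, h.cop_mul_s, (bal_mul_s_left h b).map_lift2]
  simp only [(bal 1 F).lift2_mk2]
  rfl

lemma mul_uElt (b : B) (F : Conv h A) (X : L) : (F * uElt h A b) X = F (d.mul X (d.t b)) := by
  conv_rhs => rw [← mul_one F, mul_apply, h.cop_mul_t, (bal_mul_t_right h b).map_lift2]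
  rw [mul_apply]
  congr 2
  ext x y
  rw [(bal F 1).lift2_mk2, one_apply, h.cou_mul_t_eq, uElt_apply]

instance : BRing k B (Conv h A) where
  u := AlgHom.ofLinearMap
    { toFun := uElt h A
      map_add' := fun a b => by ext X; simp [uElt_apply]
      map_smul' := fun a b => by ext X; simp [uElt_apply] }
    (by ext X; simp [uElt_apply, one_apply, h.s_one, h.mul_one])
    (fun a b => by
      ext X
      exact (by simp [uElt_apply, uElt_mul, h.mid_s, h.s_mul] :
        uElt h A (a * b) X = (uElt h A a * uElt h A b) X))

lemma u_apply (b : B) (X : L) : (u k b : Conv h A) X = u k (cou (d.mul X (d.s b))) := rfl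

lemma u_mul (b : B) (F : Conv h A) (X : L) : (u k b * F) X = F (d.mul X (d.s b)) :=
  uElt_mul b F X

lemma mul_u (b : B) (F : Conv h A) (X : L) : (F * u k b) X = F (d.mul X (d.t b)) :=
  mul_uElt b F X

lemma mul_apply_one (F G : Conv h A) : (F * G) d.one = F d.one * G d.one := by
  rw [mul_apply, h.cop_one, (bal F G).lift2_mk2]

/-- Evaluation at the unit. -/
def ev1 : Conv h A →ₐ[k] A :=
  AlgHom.ofLinearMap (ev d.one) (by simp [one_apply, h.cou_one]) mul_apply_one

@[simp] lemma ev1_apply (F : Conv h A) : ev1 F = F d.one := id rfl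

lemma ev1_u (b : B) : ev1 (u k b : Conv h A) = u k b := by
  simp [u_apply, h.one_mul, h.cou_s_self]

/-- Functoriality of the convolution algebra in the coefficients. -/
def mapC (h : Good d cop cou) (φ : A →ₐ[k] A') (hφ : ∀ b : B, φ (u k b) = u k b) :
    Conv h A →ₐ[k] Conv h A' :=
  AlgHom.ofLinearMap
    { toFun := fun F => mk (φ.toLinearMap ∘ₗ F.lin) (fun b X => by simp [map_s, hφ])
        (fun b X => by simp [map_t, hφ])
      map_add' := fun F G => by ext X; simp
      map_smul' := fun c F => by ext X; simp }
    (by ext X; simp [one_apply, hφ])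
    (fun F G => by
      ext X
      refine (map_mul_apply φ.toLinearMap F G X).trans ?_
      simp only [AlgHom.toLinearMap_apply, map_mul]
      rfl)

@[simp] lemma mapC_apply (φ : A →ₐ[k] A') (hφ : ∀ b : B, φ (u k b) = u k b) (F : Conv h A)
    (X : L) : mapC h φ hφ F X = φ (F X) := id rfl

lemma mapC_u (φ : A →ₐ[k] A') (hφ : ∀ b : B, φ (u k b) = u k b) (b : B) :
    mapC h φ hφ (u k b) = u k b := by
  ext X; simp [u_apply, hφ]

/-- Precomposition with the product. -/
def muFun (F : Conv h A) : Conv h (Conv h A) :=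
  mk
    { toFun := fun Y => mk (F.lin ∘ₗ d.mul.flip Y) (fun b X => by simp [h.s_assoc, map_s])
        (fun b X => by simp [h.t_assoc, map_t])
      map_add' := fun Y Y' => by ext X; simp
      map_smul' := fun c Y => by ext X; simp }
    (fun b Y => by ext X; simp [u_mul, h.mid_s])
    (fun b Y => by ext X; simp [mul_u, h.mid_t])

@[simp] lemma muFun_apply (F : Conv h A) (X Y : L) : muFun F Y X = F (d.mul X Y) := id rfl

lemma mul_apply₂ {Q : Type*} [AddCommGroup Q] [Module k Q] (φ : A →ₗ[k] Q)
    (F G : Conv h (Conv h A)) (X Y : L) :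
    φ ((F * G) Y X) = d.lift2 (fun y1 y2 => d.lift2 (fun x1 x2 => φ (F y1 x1 * G y2 x2))
      (cop X)) (cop Y) := by
  refine (map_mul_apply (φ ∘ₗ ev X) F G Y).trans ?_
  congr 2
  ext y1 y2
  exact map_mul_apply φ _ _ X

lemma mul_apply₃ {Q : Type*} [AddCommGroup Q] [Module k Q] (φ : A →ₗ[k] Q)
    (F G : Conv h (Conv h (Conv h A))) (X Y Z : L) :
    φ ((F * G) Z Y X) = d.lift2 (fun z1 z2 => d.lift2 (fun y1 y2 => d.lift2 (fun x1 x2 =>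
      φ (F z1 y1 x1 * G z2 y2 x2)) (cop X)) (cop Y)) (cop Z) := by
  refine (map_mul_apply (φ ∘ₗ ev X ∘ₗ ev Y) F G Z).trans ?_
  congr 2
  ext z1 z2
  exact mul_apply₂ φ _ _ X Y

/-- The algebra map induced by the product of `L`. -/
def mu : Conv h A →ₐ[k] Conv h (Conv h A) :=
  AlgHom.ofLinearMap
    { toFun := muFun
      map_add' := fun F G => by ext Y X; simp
      map_smul' := fun c F => by ext Y X; simp }
    (by
      ext Y X
      simp [one_apply, u_apply, h.cou_mul_s])
    (fun F G => by
      ext Y X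
      refine Eq.trans ?_ (mul_apply₂ LinearMap.id (muFun F) (muFun G) X Y).symm
      change (F * G) (d.mul X Y) = _
      rw [mul_apply, h.cop_mul', (bal_mulR h X).map_lift2]
      congr 2
      ext y1 y2
      rw [mulR_apply, (bal_mul_mul h y1 y2).map_lift2]
      simp only [(bal F G).lift2_mk2]
      rfl)

@[simp] lemma mu_apply (F : Conv h A) (X Y : L) : mu F Y X = F (d.mul X Y) := id rfl

lemma mu_u (hR : ∀ a X Y, cou (d.mul (d.mul X Y) (d.s a)) = cou (d.mul X (d.mul Y (d.s a))))
    (b : B) : mu (u k b : Conv h A) = u k b := by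
  ext Y X
  simp [u_apply, hR, h.cou_mul_s]

lemma mu_mapC (φ : A →ₐ[k] A') (hφ : ∀ b : B, φ (u k b) = u k b) (F : Conv h A) :
    mu (mapC h φ hφ F) = mapC h (mapC h φ hφ) (mapC_u φ hφ) (mu F) := rfl

/-- An element of a `B`-ring commuting with the image of `B`. -/
def _root_.CqST.Cent (k : Type*) (B : Type*) {A : Type*} [Field k] [Ring B] [Algebra k B] [Ring A]
    [Algebra k A] [BRing k B A] (f : A) : Prop := ∀ b : B, u k b * f = f * u k b

lemma _root_.CqST.Cent.mul {f g : A} (hf : Cent k B f) (hg : Cent k B g) : Cent k B (f * g) :=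
  fun b => by rw [← mul_assoc, hf, mul_assoc, hg, mul_assoc]

lemma _root_.CqST.Cent.of_inv {f g : A} (hf : Cent k B f) (h1 : f * g = 1) (h2 : g * f = 1) :
    Cent k B g := fun b =>
  calc u k b * g = g * (f * u k b) * g := by rw [← mul_assoc, h2, one_mul]
    _ = g * u k b := by rw [← hf, mul_assoc, mul_assoc, h1, mul_one]

lemma _root_.CqST.Cent.map {f : A} (hf : Cent k B f) (φ : A →ₐ[k] A')
    (hφ : ∀ b : B, φ (u k b) = u k b) : Cent k B (φ f) := fun b => by
  rw [← hφ, ← _root_.map_mul, hf, _root_.map_mul]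

/-- Extension of a central element by the counit in a new variable. -/
def iota (h : Good d cop cou) (f : A) (hf : Cent k B f) : Conv h A :=
  mk (LinearMap.mulRight k f ∘ₗ (u k : B →ₐ[k] A).toLinearMap ∘ₗ cou)
    (fun b X => by simp [h.cou_s_mul, mul_assoc])
    (fun b X => by simp [h.cou_t_mul, mul_assoc, hf b])

lemma iota_apply (f : A) (hf : Cent k B f) (X : L) : iota h f hf X = u k (cou X) * f := rfl

lemma iota_mul (f : A) (hf : Cent k B f) (F : Conv h A) (X : L) :
    (iota h f hf * F) X = f * F X := by
  conv_rhs => rw [← one_mul F]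
  refine Eq.trans ?_ (map_mul_apply (LinearMap.mulLeft k f) 1 F X).symm
  rw [mul_apply]
  simp only [iota_apply, one_apply, LinearMap.mulLeft_apply, ← mul_assoc, hf _]

lemma mul_iota (f : A) (hf : Cent k B f) (F : Conv h A) (X : L) :
    (F * iota h f hf) X = F X * f := by
  conv_rhs => rw [← mul_one F]
  refine Eq.trans ?_ (map_mul_apply (LinearMap.mulRight k f) F 1 X).symm
  rw [mul_apply]
  simp only [iota_apply, one_apply, LinearMap.mulRight_apply, mul_assoc]

lemma iota_mul_iota (f g : A) (hf : Cent k B f) (hg : Cent k B g) :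
    iota h f hf * iota h g hg = iota h (f * g) (hf.mul hg) := by
  ext X
  rw [iota_mul, iota_apply, iota_apply, ← mul_assoc, ← hf, mul_assoc]

lemma iota_mul_iota_inv {f g : A} (hf : Cent k B f) (hg : Cent k B g) (e : f * g = 1) :
    iota h f hf * iota h g hg = 1 := by
  rw [iota_mul_iota]
  ext X
  rw [iota_apply, e, mul_one, one_apply]

lemma cent_iota (f : A) (hf : Cent k B f) : Cent k B (iota h f hf) := fun b => by
  ext X
  rw [u_mul, mul_u, iota_apply, iota_apply, h.cou_mul_t_eq]

lemma mapC_iota (φ : A →ₐ[k] A') (hφ : ∀ b : B, φ (u k b) = u k b) (f : A) (hf : Cent k B f) :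
    mapC h φ hφ (iota h f hf) = iota h (φ f) (hf.map φ hφ) := by
  ext X
  rw [mapC_apply, iota_apply, iota_apply, _root_.map_mul, hφ]

lemma mu_iota (f : A) (hf : Cent k B f) :
    mu (iota h f hf) = iota h (iota h f hf) (cent_iota f hf) := by
  ext Y X
  rw [mu_apply, iota_apply, iota_apply, u_mul, iota_apply, h.cou_mul_s]

lemma cent_iff (F : Conv h A) :
    Cent k B F ↔ ∀ b X, F (d.mul X (d.s b)) = F (d.mul X (d.t b)) := by
  simp only [Cent, Conv.ext_iff, u_mul, mul_u]

end Conv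
end CqST

namespace CqST

variable {k} {B L : Type*} [Ring B] [Algebra k B] [AddCommGroup L] [Module k L]
variable {d : CqST k B L} {cop : L →ₗ[k] d.T2} {cou : L →ₗ[k] B}

/-- A `B`-ring in whose convolution algebra elements of `L` and of `L ⊗_B L` can be recovered. -/
abbrev GenRing (d : CqST k B L) := Module.End k (B × L × d.T2)

/-- Left multiplication by `b` on `L ⊗_B L`. -/
def sL (h : Good d cop cou) : B →ₗ[k] d.T2 →ₗ[k] d.T2 where
  toFun b := d.lift2 fun x y => d.mk2 (d.mul (d.s b) x) y
  map_add' a b := T2_ext fun x y => by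
    rw [LinearMap.add_apply]
    simp only [(Conv.bal_s_left h _).lift2_mk2]
    simp only [← mk2L_apply, map_add, LinearMap.add_apply]
  map_smul' c b := T2_ext fun x y => by
    rw [LinearMap.smul_apply]
    simp only [(Conv.bal_s_left h _).lift2_mk2]
    simp only [← mk2L_apply, map_smul, LinearMap.smul_apply, RingHom.id_apply]

lemma sL_mk2 (h : Good d cop cou) (b : B) (x y : L) :
    sL h b (d.mk2 x y) = d.mk2 (d.mul (d.s b) x) y := (Conv.bal_s_left h b).lift2_mk2 x y

/-- The action of `B` defining the `B`-ring structure of `GenRing`. -/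
def genAct (h : Good d cop cou) : B →ₗ[k] GenRing d :=
  LinearMap.mk₂ k (fun b v => (b * v.1, d.mul (d.s b) v.2.1, sL h b v.2.2))
    (fun b b' v => by simp [add_mul]) (fun c b v => by simp)
    (fun b v w => by simp [mul_add]) (fun c b v => by simp)

lemma genAct_apply (h : Good d cop cou) (b : B) (v : B × L × d.T2) :
    genAct h b v = (b * v.1, d.mul (d.s b) v.2.1, sL h b v.2.2) := rfl

/-- The `B`-ring structure of `GenRing`. -/
abbrev Good.genRing (h : Good d cop cou) : BRing k B (GenRing d) where
  u := AlgHom.ofLinearMap (genAct h)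
    (by
      refine LinearMap.ext fun v => ?_
      rw [genAct_apply, h.s_one, h.one_mul, _root_.one_mul]
      have : sL h 1 = LinearMap.id := T2_ext fun x y => by
        rw [sL_mk2, h.s_one, h.one_mul]; rfl
      rw [this]
      rfl)
    (fun a b => by
      refine LinearMap.ext fun v => ?_
      rw [Module.End.mul_apply, genAct_apply, genAct_apply, genAct_apply]
      simp only [h.s_s, mul_assoc]
      have : sL h (a * b) = sL h a ∘ₗ sL h b := T2_ext fun x y => by
        rw [LinearMap.comp_apply, sL_mk2, sL_mk2, sL_mk2, h.s_s]
      rw [this]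
      rfl)

namespace Conv
variable (h : Good d cop cou)

lemma genRing_u (b : B) (v : B × L × d.T2) :
    letI := h.genRing
    (u k b : GenRing d) v = (b * v.1, d.mul (d.s b) v.2.1, sL h b v.2.2) := rfl

/-- The element of the convolution algebra of `GenRing` recovering elements of `L`. -/
def genL : letI := h.genRing; Conv h (GenRing d) :=
  letI := h.genRing
  mk (LinearMap.mk₂ k (fun y v => (0, d.mul (d.t v.1) y, 0))
      (fun b b' v => by simp) (fun c b v => by simp)
      (fun b v w => by simp) (fun c b v => by simp))
    (fun b y => LinearMap.ext fun v => by
      rw [Module.End.mul_apply, genRing_u]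
      simp [h.s_t])
    (fun b y => LinearMap.ext fun v => by
      rw [Module.End.mul_apply, genRing_u]
      simp [h.t_t])

/-- Multiplied with `genL`, this recovers elements of `L ⊗_B L`. -/
def genT : letI := h.genRing; Conv h (GenRing d) :=
  letI := h.genRing
  mk (LinearMap.mk₂ k (fun x v => (0, 0, d.mk2 x v.2.1))
      (fun b b' v => by simp [← mk2L_apply]) (fun c b v => by simp [← mk2L_apply])
      (fun b v w => by simp [← mk2L_apply]) (fun c b v => by simp [← mk2L_apply]))
    (fun b y => LinearMap.ext fun v => by
      rw [Module.End.mul_apply, genRing_u]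
      simp [sL_mk2])
    (fun b y => LinearMap.ext fun v => by
      rw [Module.End.mul_apply, genRing_u]
      simp [mk2_bal])

/-- The `L`-component of an element of `GenRing`. -/
def exL (d : CqST k B L) : GenRing d →ₗ[k] L :=
  LinearMap.fst k L d.T2 ∘ₗ LinearMap.snd k B (L × d.T2) ∘ₗ
    LinearMap.applyₗ ((1, 0, 0) : B × L × d.T2)

/-- The `L ⊗_B L`-component of an element of `GenRing`. -/
def exT (d : CqST k B L) : GenRing d →ₗ[k] d.T2 :=
  LinearMap.snd k L d.T2 ∘ₗ LinearMap.snd k B (L × d.T2) ∘ₗ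
    LinearMap.applyₗ ((1, 0, 0) : B × L × d.T2)

lemma exL_genL (y : L) : letI := h.genRing; exL d (genL h y) = y := by
  change d.mul (d.t 1) y = y
  rw [h.t_one, h.one_mul]

lemma exT_genT_genL (x y : L) : letI := h.genRing; exT d (genT h x * genL h y) = d.mk2 x y := by
  change d.mk2 x (d.mul (d.t 1) y) = _
  rw [h.t_one, h.one_mul]

lemma exL_s (a : B) (y : L) :
    letI := h.genRing
    exL d (u k a * genL h y) = d.mul (d.s a) y := by
  let := h.genRing
  rw [← map_s, exL_genL]

lemma exL_t (a : B) (y : L) :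
    letI := h.genRing
    exL d (genL h y * u k a) = d.mul (d.t a) y := by
  let := h.genRing
  rw [← map_t, exL_genL]

lemma exT_cop (X : L) :
    letI := h.genRing
    exT d ((genT h * genL h) X) = cop X := by
  let := h.genRing
  rw [map_mul_apply]
  simp only [exT_genT_genL]
  exact lift2_mk2_eq _

/-- Elements of `L` are separated by convolution algebras. -/
lemma genL_injective {X Y : L} (e : letI := h.genRing; genL h X = genL h Y) : X = Y := by
  rw [← exL_genL h X, e, exL_genL]

end Conv

/-- A normalised invertible 2-cochain. -/
structure Twist (h : Good d cop cou) where
  hR : ∀ a X Y, cou (d.mul (d.mul X Y) (d.s a)) = cou (d.mul X (d.mul Y (d.s a)))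
  S : Conv h (Conv h B)
  Si : Conv h (Conv h B)
  cent : Cent k B S
  inv : S * Si = 1
  inv' : Si * S = 1
  one_right : S d.one = 1
  one_left : Conv.mapC h Conv.ev1 Conv.ev1_u S = 1

/-- Extension of scalars for 2-cochains. -/
def emb2 (h : Good d cop cou) (A : Type*) [Ring A] [Algebra k A] [BRing k B A] :
    Conv h (Conv h B) →ₐ[k] Conv h (Conv h A) :=
  Conv.mapC h (Conv.mapC h (u k) fun _ => rfl) (Conv.mapC_u _ _)

namespace Twist

open Conv

variable {h : Good d cop cou} (T : Twist h) {A A' : Type*} [Ring A] [Algebra k A] [BRing k B A]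
  [Ring A'] [Algebra k A'] [BRing k B A']

lemma _root_.CqST.emb2_apply (F : Conv h (Conv h B)) (X Y : L) : emb2 h A F Y X = u k (F Y X) := rfl

lemma _root_.CqST.map_map_emb2 (φ : A →ₐ[k] A') (hφ : ∀ b : B, φ (u k b) = u k b)
    (F : Conv h (Conv h B)) :
    mapC h (mapC h φ hφ) (mapC_u φ hφ) (emb2 h A F) = emb2 h A' F := by
  ext Y X
  exact hφ _

lemma cent' : Cent k B T.Si := T.cent.of_inv T.inv T.inv'

lemma one_right' : T.Si d.one = 1 := by
  have := mul_apply_one T.S T.Si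
  rwa [T.inv, T.one_right, _root_.one_mul, ← ev1_apply, _root_.map_one, eq_comm] at this

lemma one_left' : mapC h ev1 ev1_u T.Si = 1 := by
  have := _root_.map_mul (mapC h ev1 ev1_u) T.S T.Si
  rwa [T.inv, T.one_left, _root_.one_mul, _root_.map_one, eq_comm] at this

variable (A) in
/-- The cochain with extended scalars. -/
def SA : Conv h (Conv h A) := emb2 h A T.S

variable (A) in
/-- The inverse cochain with extended scalars. -/
def SiA : Conv h (Conv h A) := emb2 h A T.Si

lemma inv_A : T.SA A * T.SiA A = 1 := by
  rw [SA, SiA, ← _root_.map_mul, T.inv, _root_.map_one]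

lemma inv_A' : T.SiA A * T.SA A = 1 := by
  rw [SA, SiA, ← _root_.map_mul, T.inv', _root_.map_one]

lemma cent_A : Cent k B (T.SA A) := T.cent.map _ (mapC_u _ _)
lemma cent_A' : Cent k B (T.SiA A) := T.cent'.map _ (mapC_u _ _)

/-- The algebra map induced by the twisted product. -/
def tmu : Conv h A →ₐ[k] Conv h (Conv h A) :=
  AlgHom.ofLinearMap
    (LinearMap.mulLeft k (T.SA A) ∘ₗ LinearMap.mulRight k (T.SiA A) ∘ₗ (mu (h := h)).toLinearMap)
    (by simp [inv_A])
    (fun F G => by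
      simp only [LinearMap.comp_apply, LinearMap.mulLeft_apply, LinearMap.mulRight_apply,
        AlgHom.toLinearMap_apply, _root_.map_mul]
      calc _ = T.SA A * mu F * 1 * mu G * T.SiA A := by simp only [_root_.mul_one, mul_assoc]
        _ = _ := by rw [← T.inv_A']; simp only [mul_assoc])

lemma tmu_eq (F : Conv h A) : T.tmu F = T.SA A * (mu F * T.SiA A) := rfl

lemma tmu_u (b : B) : T.tmu (u k b : Conv h A) = u k b := by
  rw [tmu_eq, mu_u T.hR, ← mul_assoc, ← T.cent_A, mul_assoc, inv_A, _root_.mul_one]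

/-- The twisted product. -/
def pr (X Y : L) : L := d.prodSigma cop (fun x y => T.S y x) (fun x y => T.Si y x) X Y

lemma _root_.CqST.Conv.mul_mul_apply₂ {Q : Type*} [AddCommGroup Q] [Module k Q] (φ : A →ₗ[k] Q)
    (F G H : Conv h (Conv h A)) (X Y : L) :
    φ ((F * (G * H)) Y X) = d.lift2 (fun y1 y23 => d.lift2 (fun y2 y3 => d.lift2 (fun x1 x23 =>
      d.lift2 (fun x2 x3 => φ (F y1 x1 * (G y2 x2 * H y3 x3))) (cop x23)) (cop X))
      (cop y23)) (cop Y) := by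
  refine (map_mul_apply (φ ∘ₗ ev X) F (G * H) Y).trans ?_
  congr 2
  ext y1 y23
  refine (map_mul_apply (φ ∘ₗ ev X ∘ₗ LinearMap.mulLeft k (F y1)) G H y23).trans ?_
  congr 2
  ext y2 y3
  refine (map_mul_apply φ (F y1) (G y2 * H y3) X).trans ?_
  congr 2
  ext x1 x23
  exact map_mul_apply (φ ∘ₗ LinearMap.mulLeft k (F y1 x1)) (G y2) (H y3) x23

lemma pr_eq (X Y : L) : letI := h.genRing; T.pr X Y = exL d (T.tmu (genL h) Y X) := by
  let := h.genRing
  rw [tmu_eq, mul_mul_apply₂]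
  rw [pr, prodSigma]
  simp only [SA, SiA, emb2_apply, mu_apply, ← map_t, ← map_s, exL_genL]

lemma apply_pr (F : Conv h A) (X Y : L) : F (T.pr X Y) = T.tmu F Y X := by
  let := h.genRing
  rw [pr_eq, tmu_eq, tmu_eq]
  refine (mul_mul_apply₂ (F.lin ∘ₗ exL d) (T.SA _) (mu (genL h)) (T.SiA _) X Y).trans ?_
  refine Eq.trans ?_ (mul_mul_apply₂ LinearMap.id (T.SA _) (mu F) (T.SiA _) X Y).symm
  simp only [SA, SiA, emb2_apply, mu_apply, ← map_t, ← map_s, exL_genL, LinearMap.comp_apply,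
    lin_apply, LinearMap.id_apply]

/-- Elements of `L` are equal if every convolution algebra element agrees on them. -/
lemma _root_.CqST.Conv.eq_of_forall (h : Good d cop cou) {X Y : L}
    (e : letI := h.genRing; ∀ F : Conv h (GenRing d), F X = F Y) : X = Y :=
  genL_injective h (e _)

lemma pr_linear : ∃ p' : L →ₗ[k] L →ₗ[k] L, ∀ X Y, p' X Y = T.pr X Y := by
  let := h.genRing
  refine ⟨LinearMap.mk₂ k T.pr ?_ ?_ ?_ ?_, fun X Y => rfl⟩ <;>
  intros <;> simp only [pr_eq, _root_.map_add, _root_.map_smul, Conv.add_apply, Conv.smul_apply]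

lemma tmu_one (F : Conv h A) : T.tmu F d.one = F := by
  rw [tmu_eq, mul_apply_one, mul_apply_one, SA, SiA, emb2, mapC_apply, mapC_apply, T.one_right,
    T.one_right', _root_.map_one, _root_.one_mul, _root_.mul_one]
  ext X
  rw [mu_apply, h.mul_one]

lemma map_ev1_emb2 (F : Conv h (Conv h B)) (hF : mapC h ev1 ev1_u F = 1) :
    mapC h ev1 ev1_u (emb2 h A F) = 1 := by
  ext Y
  have := DFunLike.congr_fun hF Y
  simp only [mapC_apply, ev1_apply] at this ⊢
  rw [emb2_apply, this]
  rfl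

lemma map_ev1_tmu (F : Conv h A) : mapC h ev1 ev1_u (T.tmu F) = F := by
  rw [tmu_eq, _root_.map_mul, _root_.map_mul, SA, SiA, map_ev1_emb2 _ T.one_left,
    map_ev1_emb2 _ T.one_left', _root_.one_mul, _root_.mul_one]
  ext X
  simp [h.one_mul]

lemma pr_one (X : L) : T.pr X d.one = X := eq_of_forall h fun F => by rw [apply_pr, tmu_one]

lemma one_pr (X : L) : T.pr d.one X = X := by
  let := h.genRing
  refine eq_of_forall h fun F => ?_
  rw [apply_pr]
  exact DFunLike.congr_fun (T.map_ev1_tmu F) X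

lemma s_pr (b : B) (X Y : L) : T.pr (d.mul (d.s b) X) Y = d.mul (d.s b) (T.pr X Y) := by
  let := h.genRing
  exact eq_of_forall h fun F => by simp only [apply_pr, map_s]

lemma t_pr (b : B) (X Y : L) : T.pr (d.mul (d.t b) X) Y = d.mul (d.t b) (T.pr X Y) := by
  let := h.genRing
  exact eq_of_forall h fun F => by simp only [apply_pr, map_t]

lemma pr_s_left (b : B) (X : L) : T.pr (d.s b) X = d.mul (d.s b) X := by
  rw [← h.mul_one (d.s b), s_pr, one_pr, h.mul_one]

lemma pr_t_left (b : B) (X : L) : T.pr (d.t b) X = d.mul (d.t b) X := by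
  rw [← h.mul_one (d.t b), t_pr, one_pr, h.mul_one]

lemma pr_s (b : B) (X : L) : T.pr X (d.s b) = d.mul X (d.s b) := by
  let := h.genRing
  refine eq_of_forall h fun F => ?_
  rw [apply_pr, ← h.mul_one (d.s b), map_s, u_mul, tmu_one, h.mul_one]

lemma pr_t (b : B) (X : L) : T.pr X (d.t b) = d.mul X (d.t b) := by
  let := h.genRing
  refine eq_of_forall h fun F => ?_
  rw [apply_pr, ← h.mul_one (d.t b), map_t, mul_u, tmu_one, h.mul_one]

lemma cou_pr (X Y : L) : cou (T.pr X Y) = cou (d.mul X Y) := by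
  have : (1 : Conv h B) (T.pr X Y) = (1 : Conv h B) (d.mul X Y) := by
    rw [apply_pr, _root_.map_one, ← mu_apply, _root_.map_one]
  exact this

lemma bal_pr (X : L) : d.Bal fun y1 y2 => d.lift2 (fun x1 x2 =>
    d.mk2 (T.pr x1 y1) (T.pr x2 y2)) (cop X) := by
  let := h.genRing
  convert (bal (T.tmu (genT h)) (T.tmu (genL h))).comp (exT d ∘ₗ ev X) using 3 with y1 y2
  rw [LinearMap.comp_apply, ev_apply, map_mul_apply]
  simp only [← apply_pr, exT_genT_genL]

lemma bal_pr' (y1 y2 : L) : d.Bal fun x1 x2 => d.mk2 (T.pr x1 y1) (T.pr x2 y2) := by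
  let := h.genRing
  convert (bal (T.tmu (genT h) y1) (T.tmu (genL h) y2)).comp (exT d) using 3 with x1 x2
  simp only [← apply_pr, exT_genT_genL]

lemma cop_pr (X Y : L) : cop (T.pr X Y) = d.lift2 (fun y1 y2 => d.lift2 (fun x1 x2 =>
    d.mk2 (T.pr x1 y1) (T.pr x2 y2)) (cop X)) (cop Y) := by
  let := h.genRing
  rw [← exT_cop h, apply_pr, _root_.map_mul, mul_apply₂]
  simp only [← apply_pr, exT_genT_genL]

lemma _root_.CqST.tlift_tmul {M N Q : Type*} [AddCommGroup M] [Module k M]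
    [AddCommGroup N] [Module k N] [AddCommGroup Q] [Module k Q]
    (f : M →ₗ[k] N →ₗ[k] Q) : tlift k (fun x y => f x y) = TensorProduct.lift f := by
  have hex : ∃ F : M ⊗[k] N →ₗ[k] Q, ∀ x y, F (x ⊗ₜ[k] y) = f x y :=
    ⟨TensorProduct.lift f, fun x y => TensorProduct.lift.tmul x y⟩
  unfold tlift
  rw [dif_pos hex]
  exact TensorProduct.ext' fun x y => (hex.choose_spec x y).trans (TensorProduct.lift.tmul x y).symm

lemma mulT2P_pr (X Y : L) : d.mulT2P T.pr (cop X) (cop Y) = cop (T.pr X Y) := by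
  obtain ⟨p', hp⟩ := T.pr_linear
  have key : ∀ zr wr : L ⊗[k] L, Submodule.Quotient.mk zr = cop X →
      Submodule.Quotient.mk wr = cop Y → (Submodule.Quotient.mk
        ((tlift k (fun x1 x2 => (tlift k (fun y1 y2 => (T.pr x1 y1) ⊗ₜ[k] (T.pr x2 y2))) wr)) zr) :
          d.T2) = cop (T.pr X Y) := by
    intro zr wr hz hw
    rw [cop_pr, ← hw]
    have e1 : ∀ x1 x2, tlift k (fun y1 y2 => (T.pr x1 y1) ⊗ₜ[k] (T.pr x2 y2)) =
        TensorProduct.map (p' x1) (p' x2) := fun x1 x2 => by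
      simp only [← hp]
      exact tlift_tmul ((TensorProduct.mk k L L).compl₁₂ (p' x1) (p' x2))
    simp only [e1]
    let M := TensorProduct.lift ((TensorProduct.mapBilinear (RingHom.id k) L L L L).compl₁₂ p' p')
    have e2 : tlift k (fun x1 x2 => TensorProduct.map (p' x1) (p' x2) wr) =
        LinearMap.applyₗ wr ∘ₗ M :=
      (tlift_tmul ((TensorProduct.mapBilinear (RingHom.id k) L L L L).compl₁₂ p' p' |>.compr₂
        (LinearMap.applyₗ wr))).trans (TensorProduct.ext' fun x y => by simp [M])
    rw [e2, LinearMap.comp_apply, LinearMap.applyₗ_apply_apply]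
    clear hw e1 e2
    induction wr using TensorProduct.induction_on with
    | zero =>
      rw [Submodule.Quotient.mk_zero, _root_.map_zero, _root_.map_zero,
        Submodule.Quotient.mk_zero]
    | add w w' h1 h2 =>
      rw [Submodule.Quotient.mk_add, _root_.map_add, _root_.map_add, ← h1, ← h2,
        Submodule.Quotient.mk_add]
    | tmul y1 y2 =>
      have := (T.bal_pr X).lift2_mk2 y1 y2
      rw [mk2] at this
      rw [this, ← hz]
      clear hz this
      induction zr using TensorProduct.induction_on with
      | zero => simp
      | add z z' h1 h2 =>
        rw [_root_.map_add, LinearMap.add_apply, Submodule.Quotient.mk_add, h1, h2,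
          Submodule.Quotient.mk_add, _root_.map_add]
      | tmul x1 x2 =>
        refine Eq.trans ?_ ((T.bal_pr' y1 y2).lift2_mk2 x1 x2).symm
        simp [hp, mk2, M]
  have hex : ∃ u : d.T2, ∀ zr wr : L ⊗[k] L, Submodule.Quotient.mk zr = cop X →
      Submodule.Quotient.mk wr = cop Y → (Submodule.Quotient.mk
        ((tlift k (fun x1 x2 => (tlift k (fun y1 y2 => (T.pr x1 y1) ⊗ₜ[k] (T.pr x2 y2))) wr)) zr) :
          d.T2) = u := ⟨_, key⟩
  obtain ⟨zr, hz⟩ := Submodule.Quotient.mk_surjective _ (cop X)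
  obtain ⟨wr, hw⟩ := Submodule.Quotient.mk_surjective _ (cop Y)
  rw [mulT2P, dif_pos hex, ← hex.choose_spec zr wr hz hw, key zr wr hz hw]

end Twist
end CqST

namespace CqST

variable {k} {B L : Type*} [Ring B] [Algebra k B] [AddCommGroup L] [Module k L]
variable {d : CqST k B L} {cop : L →ₗ[k] d.T2} {cou : L →ₗ[k] B}

open Conv

/-- Extension of scalars for 3-cochains. -/
def emb3 (h : Good d cop cou) (A : Type*) [Ring A] [Algebra k A] [BRing k B A] :
    Conv h (Conv h (Conv h B)) →ₐ[k] Conv h (Conv h (Conv h A)) :=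
  mapC h (emb2 h A) (mapC_u _ _)

lemma emb3_apply {h : Good d cop cou} {A : Type*} [Ring A] [Algebra k A] [BRing k B A]
    (F : Conv h (Conv h (Conv h B))) (X Y Z : L) : emb3 h A F Z Y X = u k (F Z Y X) := rfl

/-- An invertible normalised 3-cocycle, in terms of convolution algebras. -/
structure Cocycle (h : Good d cop cou)
    (hR : ∀ a X Y, cou (d.mul (d.mul X Y) (d.s a)) = cou (d.mul X (d.mul Y (d.s a)))) where
  Φ : Conv h (Conv h (Conv h B))
  Φi : Conv h (Conv h (Conv h B))
  cent : Cent k B Φ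
  inv : Φ * Φi = 1
  inv' : Φi * Φ = 1
  norm_left : mapC h (mapC h ev1 ev1_u) (mapC_u _ _) Φ = 1
  norm_mid : mapC h ev1 ev1_u Φ = 1
  assoc_genL : letI := h.genRing
    emb3 h (GenRing d) Φ * mapC h mu (mu_u hR) (mu (genL h)) =
      mu (mu (genL h)) * emb3 h (GenRing d) Φ
  pentagon : mu Φ * mapC h (mapC h mu (mu_u hR)) (mapC_u _ _) Φ =
    emb3 h (Conv h B) Φ * (mapC h mu (mu_u hR) Φ * iota h Φ cent)

namespace Cocycle

variable {h : Good d cop cou}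
  {hR : ∀ a X Y, cou (d.mul (d.mul X Y) (d.s a)) = cou (d.mul X (d.mul Y (d.s a)))}
  (C : Cocycle h hR) {A : Type*} [Ring A] [Algebra k A] [BRing k B A]

lemma assoc (F : Conv h A) :
    emb3 h A C.Φ * mapC h mu (mu_u hR) (mu F) = mu (mu F) * emb3 h A C.Φ := by
  let := h.genRing
  ext Z Y X
  have e := congrArg (fun G => F (exL d (G Z Y X))) C.assoc_genL
  have h1 := mul_apply₃ (F.lin ∘ₗ exL d) (emb3 h (GenRing d) C.Φ)
    (mapC h mu (mu_u hR) (mu (genL h))) X Y Z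
  have h2 := mul_apply₃ (F.lin ∘ₗ exL d) (mu (mu (genL h))) (emb3 h (GenRing d) C.Φ) X Y Z
  have h3 := mul_apply₃ LinearMap.id (emb3 h A C.Φ) (mapC h mu (mu_u hR) (mu F)) X Y Z
  have h4 := mul_apply₃ LinearMap.id (mu (mu F)) (emb3 h A C.Φ) X Y Z
  simp only [LinearMap.comp_apply, lin_apply, emb3_apply, mapC_apply, mu_apply, exL_s, exL_t,
    map_s, map_t, LinearMap.id_apply] at h1 h2 h3 h4
  rw [h3, h4, ← h1, ← h2]
  exact e

end Cocycle

namespace Twist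

variable {h : Good d cop cou} (T : Twist h) (C : Cocycle h T.hR)
  {A A' : Type*} [Ring A] [Algebra k A] [BRing k B A] [Ring A'] [Algebra k A'] [BRing k B A']

lemma mapC_SA (φ : A →ₐ[k] A') (hφ : ∀ b : B, φ (u k b) = u k b) :
    mapC h (mapC h φ hφ) (mapC_u φ hφ) (T.SA A) = T.SA A' := map_map_emb2 φ hφ _

variable (A) in
/-- The twisted cocycle. -/
def PA : Conv h (Conv h (Conv h A)) :=
  T.SA (Conv h A) * (mu (T.SA A) * (emb3 h A C.Φ * (mapC h mu (mu_u T.hR) (T.SiA A) *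
    iota h (T.SiA A) T.cent_A')))

variable (A) in
/-- The inverse of the twisted cocycle. -/
def PiA : Conv h (Conv h (Conv h A)) :=
  iota h (T.SA A) T.cent_A * mapC h mu (mu_u T.hR) (T.SA A) * emb3 h A C.Φi * mu (T.SiA A) *
    T.SiA (Conv h A)

lemma inv_map {R : Type*} [Ring R] [Algebra k R] (φ : Conv h (Conv h A) →ₐ[k] R) :
    φ (T.SA A) * φ (T.SiA A) = 1 := by
  rw [← _root_.map_mul, inv_A, _root_.map_one]

lemma inv_map' {R : Type*} [Ring R] [Algebra k R] (φ : Conv h (Conv h A) →ₐ[k] R) :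
    φ (T.SiA A) * φ (T.SA A) = 1 := by
  rw [← _root_.map_mul, inv_A', _root_.map_one]

lemma iota_inv : iota h (T.SA A) T.cent_A * iota h (T.SiA A) T.cent_A' = 1 :=
  iota_mul_iota_inv _ _ T.inv_A

lemma iota_inv' : iota h (T.SiA A) T.cent_A' * iota h (T.SA A) T.cent_A = 1 :=
  iota_mul_iota_inv _ _ T.inv_A'

lemma _root_.CqST.five_mul_inv {R : Type*} [Monoid R] {a b c e f a' b' c' e' f' : R}
    (ha : a * a' = 1) (hb : b * b' = 1) (hc : c * c' = 1) (he : e * e' = 1) (hf : f * f' = 1) :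
    a * (b * (c * (e * f))) * (f' * e' * c' * b' * a') = 1 := by
  simp only [mul_assoc]
  rw [← mul_assoc f, hf, _root_.one_mul, ← mul_assoc e, he, _root_.one_mul, ← mul_assoc c, hc,
    _root_.one_mul, ← mul_assoc b, hb, _root_.one_mul, ha]

lemma PA_mul_PiA : T.PA C A * T.PiA C A = 1 :=
  five_mul_inv T.inv_A (T.inv_map mu) (by rw [← _root_.map_mul, C.inv, _root_.map_one])
    (T.inv_map' (mapC h mu (mu_u T.hR))) T.iota_inv'

lemma PiA_mul_PA : T.PiA C A * T.PA C A = 1 := by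
  have := five_mul_inv (T.iota_inv (A := A)) (T.inv_map (A := A) (mapC h mu (mu_u T.hR)))
    (by rw [← _root_.map_mul, C.inv', _root_.map_one] : emb3 h A C.Φi * emb3 h A C.Φ = 1)
    (T.inv_map' (A := A) mu) (T.inv_A' (A := Conv h A))
  simpa only [PiA, PA, mul_assoc] using this

lemma cent_PA : Cent k B (T.PA C A) :=
  T.cent_A.mul (((T.cent_A).map _ (mu_u T.hR)).mul ((C.cent.map _ (mapC_u _ _)).mul
    (((T.cent_A').map _ (mapC_u _ _)).mul (cent_iota _ _))))

lemma emb3_PA : emb3 h A (T.PA C B) = T.PA C A := by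
  have h1 : emb3 h A (T.SA (Conv h B)) = T.SA (Conv h A) := T.mapC_SA _ (mapC_u _ _)
  have h2 : emb3 h A (mu (T.SA B)) = mu (T.SA A) := rfl
  have h3 : emb3 h A (mapC h mu (mu_u T.hR) (T.SiA B)) = mapC h mu (mu_u T.hR) (T.SiA A) := rfl
  have h4 : emb3 h A (iota h (T.SiA B) T.cent_A') = iota h (T.SiA A) T.cent_A' :=
    (mapC_iota (emb2 h A) _ _ T.cent_A').trans rfl
  have h5 : emb3 h A (emb3 h B C.Φ) = emb3 h A C.Φ := rfl
  simp only [PA, _root_.map_mul, h1, h2, h3, h4, h5]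

lemma mapC_tmu (F : Conv h (Conv h A)) :
    mapC h T.tmu T.tmu_u F = iota h (T.SA A) T.cent_A * (mapC h mu (mu_u T.hR) F *
      iota h (T.SiA A) T.cent_A') := by
  ext1 W
  rw [iota_mul, mul_iota]
  rfl

lemma mapC_mapC_tmu (F : Conv h (Conv h (Conv h A))) :
    mapC h (mapC h T.tmu T.tmu_u) (mapC_u _ _) F =
      iota h (iota h (T.SA A) T.cent_A) (cent_iota _ _) *
      (mapC h (mapC h mu (mu_u T.hR)) (mapC_u _ _) F *
      iota h (iota h (T.SiA A) T.cent_A') (cent_iota _ _)) := by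
  ext1 W
  rw [iota_mul, mul_iota]
  exact T.mapC_tmu (F W)

lemma assoc_PA (F : Conv h A) :
    T.PA C A * mapC h T.tmu T.tmu_u (T.tmu F) = T.tmu (T.tmu F) * T.PA C A := by
  rw [mapC_tmu, tmu_eq, tmu_eq, PA]
  simp only [_root_.map_mul]
  have e1 := T.iota_inv' (A := A)
  have e2 := T.inv_map' (A := A) (mapC h mu (mu_u T.hR))
  have e3 := C.assoc F
  have e4 := T.inv_A' (A := Conv h A)
  have e5 := T.inv_map' (A := A) mu
  generalize iota h (T.SiA A) T.cent_A' = i1 at *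
  generalize iota h (T.SA A) T.cent_A = i2 at *
  generalize mapC h mu (mu_u T.hR) (T.SiA A) = i3 at *
  generalize mapC h mu (mu_u T.hR) (T.SA A) = i4 at *
  generalize mapC h mu (mu_u T.hR) (mu F) = i5 at *
  generalize emb3 h A C.Φ = i6 at *
  generalize mu (mu F) = i7 at *
  generalize T.SiA (Conv h A) = i8 at *
  generalize T.SA (Conv h A) = i9 at *
  generalize mu (T.SiA A) = j1 at *
  generalize mu (T.SA A) = j2 at *
  calc _ = i9 * j2 * i6 * i3 * (i1 * i2) * i4 * i5 * i3 * i1 := by simp only [mul_assoc]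
    _ = i9 * j2 * i6 * (i3 * i4) * i5 * i3 * i1 := by rw [e1]; simp only [mul_assoc, _root_.one_mul]
    _ = i9 * j2 * (i6 * i5) * i3 * i1 := by rw [e2]; simp only [mul_assoc, _root_.one_mul]
    _ = i9 * j2 * i7 * 1 * i6 * i3 * i1 := by rw [e3]; simp only [mul_assoc, _root_.one_mul]
    _ = i9 * j2 * i7 * (j1 * j2) * i6 * i3 * i1 := by rw [e5]
    _ = i9 * j2 * i7 * j1 * 1 * j2 * i6 * i3 * i1 := by simp only [mul_assoc, _root_.one_mul]
    _ = i9 * j2 * i7 * j1 * (i8 * i9) * j2 * i6 * i3 * i1 := by rw [e4]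
    _ = _ := by simp only [mul_assoc]

lemma norm_left_PA : mapC h (mapC h ev1 ev1_u) (mapC_u _ _) (T.PA C B) = 1 := by
  have h1 : mapC h (mapC h ev1 ev1_u) (mapC_u _ _) (T.SA (Conv h B)) = T.SA B := T.mapC_SA _ ev1_u
  have h2 : mapC h (mapC h ev1 ev1_u) (mapC_u _ _) (mu (T.SA B)) = 1 := by
    rw [← mu_mapC, SA, map_ev1_emb2 _ T.one_left, _root_.map_one]
  have h3 : mapC h (mapC h ev1 ev1_u) (mapC_u _ _) (emb3 h B C.Φ) = 1 := C.norm_left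
  have h4 : mapC h (mapC h ev1 ev1_u) (mapC_u _ _) (mapC h mu (mu_u T.hR) (T.SiA B)) = T.SiA B := by
    ext Z Y
    simp [h.one_mul]
  have h5 : mapC h (mapC h ev1 ev1_u) (mapC_u _ _) (iota h (T.SiA B) T.cent_A') = 1 := by
    rw [mapC_iota]
    ext1 Z
    rw [iota_apply, SiA, map_ev1_emb2 _ T.one_left', _root_.mul_one]
    rfl
  simp only [PA, _root_.map_mul, h1, h2, h3, h4, h5, _root_.one_mul, _root_.mul_one, inv_A]

lemma norm_mid_PA : mapC h ev1 ev1_u (T.PA C B) = 1 := by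
  have h1 : mapC h ev1 ev1_u (T.SA (Conv h B)) = 1 := by
    ext1 Z
    have : mapC h ev1 ev1_u T.S Z = cou Z := by rw [T.one_left]; rfl
    rw [mapC_apply, ev1_apply, SA, emb2_apply]
    rw [mapC_apply, ev1_apply] at this
    rw [this]
    rfl
  have h2 : mapC h ev1 ev1_u (mu (T.SA B)) = T.SA B := by
    ext Z Y
    simp [h.one_mul]
  have h3 : mapC h ev1 ev1_u (emb3 h B C.Φ) = 1 := C.norm_mid
  have h4 : mapC h ev1 ev1_u (mapC h mu (mu_u T.hR) (T.SiA B)) = T.SiA B := by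
    ext Z Y
    simp [h.mul_one]
  have h5 : mapC h ev1 ev1_u (iota h (T.SiA B) T.cent_A') = 1 := by
    rw [mapC_iota]
    ext1 Z
    have : (ev1 (T.SiA B) : Conv h B) = 1 := by
      rw [ev1_apply, SiA, emb2, mapC_apply, T.one_right', _root_.map_one]
    rw [iota_apply, this, _root_.mul_one]
    rfl
  simp only [PA, _root_.map_mul, h1, h2, h3, h4, h5, _root_.one_mul, _root_.mul_one, inv_A]

lemma _root_.CqST.pentagon_aux {R : Type*} [Monoid R]
    {a b m1 m2 m3 m4 m5 j n2 n3 n4 n5 e3 e4 c0 c0' c1 c2 c3 c4 c5 i2 i3 : R}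
    (hba : b * a = 1) (hjb : j * b = b * j) (hmj : m5 * j = 1) (hmn : m4 * n2 = 1)
    (hec : e4 * c1 = 1) (hc0 : c0' * c0 = 1) (hci : c5 * i2 = 1)
    (hA : e3 * c2 = m2 * e3) (hB : c4 * i3 = i3 * n4) (hC : m3 * n3 = e3 * (c3 * i3)) :
    a * (m1 * (m2 * (m3 * (m4 * m5))) * b) * (j * (a * (n2 * (n3 * (n4 * n5))) * m5)) =
      a * (m1 * (e3 * (e4 * c0'))) *
        (c0 * (c1 * (c2 * (c3 * (c4 * c5))) * c0') * (c0 * (i2 * (i3 * (n5 * m5))))) := by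
  calc _ = a * m1 * m2 * m3 * m4 * m5 * (b * j) * a * n2 * n3 * n4 * n5 * m5 := by
        simp only [mul_assoc]
    _ = a * m1 * m2 * m3 * m4 * (m5 * j) * (b * a) * n2 * n3 * n4 * n5 * m5 := by
        rw [← hjb]; simp only [mul_assoc]
    _ = a * m1 * m2 * m3 * (m4 * n2) * n3 * n4 * n5 * m5 := by
        rw [hmj, hba]; simp only [mul_assoc, _root_.one_mul]
    _ = a * m1 * m2 * (m3 * n3) * n4 * n5 * m5 := by
        rw [hmn]; simp only [mul_assoc, _root_.one_mul]
    _ = a * m1 * (m2 * e3) * c3 * (i3 * n4) * n5 * m5 := by rw [hC]; simp only [mul_assoc]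
    _ = a * m1 * e3 * c2 * c3 * c4 * 1 * i3 * n5 * m5 := by
        rw [← hA, ← hB]; simp only [mul_assoc, _root_.one_mul]
    _ = a * m1 * e3 * 1 * c2 * c3 * c4 * (c5 * i2) * i3 * n5 * m5 := by
        rw [hci]; simp only [mul_assoc, _root_.one_mul]
    _ = a * m1 * e3 * (e4 * c1) * c2 * c3 * c4 * c5 * 1 * i2 * i3 * n5 * m5 := by
        rw [hec]; simp only [mul_assoc, _root_.one_mul]
    _ = a * m1 * e3 * e4 * 1 * c1 * c2 * c3 * c4 * c5 * (c0' * c0) * i2 * i3 * n5 * m5 := by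
        rw [hc0]; simp only [mul_assoc, _root_.one_mul]
    _ = a * m1 * e3 * e4 * (c0' * c0) * c1 * c2 * c3 * c4 * c5 * (c0' * c0) * i2 * i3 * n5 *
        m5 := by rw [hc0]
    _ = _ := by simp only [mul_assoc]

end Twist
end CqST

namespace CqST

variable {k} {B L : Type*} [Ring B] [Algebra k B] [AddCommGroup L] [Module k L]
variable {d : CqST k B L} {cop : L →ₗ[k] d.T2} {cou : L →ₗ[k] B}

open Conv

lemma emb3_self {h : Good d cop cou} (F : Conv h (Conv h (Conv h B))) : emb3 h B F = F := by
  ext Z Y X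
  exact u_self (k := k) _

namespace Twist

variable {h : Good d cop cou} (T : Twist h) (C : Cocycle h T.hR)

lemma pentagon_PA : T.tmu (T.PA C B) * mapC h (mapC h T.tmu T.tmu_u) (mapC_u _ _) (T.PA C B) =
    T.PA C (Conv h B) * (mapC h T.tmu T.tmu_u (T.PA C B) * iota h (T.PA C B) (T.cent_PA C)) := by
  have hmu : Cent k B (mu (T.SA B)) := (T.cent_A).map _ (mu_u T.hR)
  have hmu' : Cent k B (mu (T.SiA B)) := (T.cent_A').map _ (mu_u T.hR)
  have hmm : Cent k B (mapC h mu (mu_u T.hR) (T.SiA B)) := (T.cent_A').map _ (mapC_u _ _)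
  have hΦ : Cent k B (emb3 h B C.Φ) := C.cent.map _ (mapC_u _ _)
  have hιi := cent_iota (h := h) (T.SiA B) T.cent_A'
  have en1 : mapC h (mapC h mu (mu_u T.hR)) (mapC_u _ _) (T.SA (Conv h B)) =
    T.SA (Conv h (Conv h B)) := T.mapC_SA _ (mu_u T.hR)
  have en5 : mapC h (mapC h mu (mu_u T.hR)) (mapC_u _ _) (iota h (T.SiA B) T.cent_A') =
    iota h (mapC h mu (mu_u T.hR) (T.SiA B)) hmm := mapC_iota _ _ _ _
  have em5 : mu (iota h (T.SiA B) T.cent_A') = iota h (iota h (T.SiA B) T.cent_A') hιi :=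
    mu_iota _ _
  have ec5 : mapC h mu (mu_u T.hR) (iota h (T.SiA B) T.cent_A') =
    iota h (mu (T.SiA B)) hmu' := mapC_iota _ _ _ _
  have ei : iota h (T.PA C B) (T.cent_PA C) = iota h (T.SA (Conv h B)) T.cent_A *
      (iota h (mu (T.SA B)) hmu * (iota h (emb3 h B C.Φ) hΦ *
        (iota h (mapC h mu (mu_u T.hR) (T.SiA B)) hmm *
          iota h (iota h (T.SiA B) T.cent_A') hιi))) :=
    by simp only [iota_mul_iota]; rfl
  rw [mapC_mapC_tmu, mapC_tmu, tmu_eq, ei]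
  conv_lhs => rw [PA]
  simp only [PA, _root_.map_mul]
  rw [en1, en5, em5, ec5]
  refine pentagon_aux T.inv_A' ?_ ?_ ?_ ?_ ?_ ?_ ?_ ?_ ?_
  · ext1 W
    rw [iota_mul, mul_iota]
    ext1 Z
    rw [iota_mul, mul_iota]
    exact (T.cent_A _).symm
  · exact iota_mul_iota_inv _ _ T.iota_inv'
  · exact T.inv_map' ((mu (h := h)).comp (mapC h mu (mu_u T.hR)))
  · exact T.inv_map' (mapC h mu (mu_u T.hR))
  · exact T.iota_inv'
  · exact iota_mul_iota_inv _ _ (T.inv_map' mu)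
  · exact C.assoc (T.SA B)
  · ext1 W
    rw [iota_mul, mul_iota]
    exact (C.assoc (T.SiA B W)).symm
  · have := C.pentagon
    simp only [emb3_self]
    exact this

end Twist
end CqST

namespace CqST

variable {k} {B L : Type*} [Ring B] [Algebra k B] [AddCommGroup L] [Module k L]
variable {d : CqST k B L} {cop : L →ₗ[k] d.T2} {cou : L →ₗ[k] B}

namespace Conv

variable {h : Good d cop cou} {A : Type*} [Ring A] [Algebra k A] [BRing k B A]
  {Q : Type*} [AddCommGroup Q] [Module k Q]

lemma mul_mul_apply (φ : A →ₗ[k] Q) (F G H : Conv h A) (X : L) :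
    φ ((F * (G * H)) X) = d.lift2 (fun x1 x23 => d.lift2 (fun x2 x3 =>
      φ (F x1 * (G x2 * H x3))) (cop x23)) (cop X) := by
  refine (map_mul_apply φ F (G * H) X).trans ?_
  congr 2
  ext x1 x23
  exact map_mul_apply (φ ∘ₗ LinearMap.mulLeft k (F x1)) G H x23

lemma mul_mul_mul_apply (φ : A →ₗ[k] Q) (F G H I : Conv h A) (X : L) :
    φ ((F * (G * (H * I))) X) = d.lift2 (fun x1 x234 => d.lift2 (fun x2 x34 =>
      d.lift2 (fun x3 x4 => φ (F x1 * (G x2 * (H x3 * I x4)))) (cop x34)) (cop x234)) (cop X) := by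
  refine (map_mul_apply φ F (G * (H * I)) X).trans ?_
  congr 2
  ext x1 x234
  exact mul_mul_apply (φ ∘ₗ LinearMap.mulLeft k (F x1)) G H I x234

lemma mul_mul_mul_mul_apply (φ : A →ₗ[k] Q) (F G H I J : Conv h A) (X : L) :
    φ ((F * (G * (H * (I * J)))) X) = d.lift2 (fun x1 x2345 => d.lift2 (fun x2 x345 =>
      d.lift2 (fun x3 x45 => d.lift2 (fun x4 x5 => φ (F x1 * (G x2 * (H x3 * (I x4 * J x5)))))
        (cop x45)) (cop x345)) (cop x2345)) (cop X) := by
  refine (map_mul_apply φ F (G * (H * (I * J))) X).trans ?_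
  congr 2
  ext x1 x2345
  exact mul_mul_mul_apply (φ ∘ₗ LinearMap.mulLeft k (F x1)) G H I J x2345

lemma mul_apply₄ (φ : A →ₗ[k] Q)
    (F G : Conv h (Conv h (Conv h (Conv h A)))) (X Y Z W : L) :
    φ ((F * G) W Z Y X) = d.lift2 (fun w1 w2 => d.lift2 (fun z1 z2 => d.lift2 (fun y1 y2 =>
      d.lift2 (fun x1 x2 => φ (F w1 z1 y1 x1 * G w2 z2 y2 x2)) (cop X)) (cop Y)) (cop Z))
      (cop W) := by
  refine (map_mul_apply (φ ∘ₗ ev X ∘ₗ ev Y ∘ₗ ev Z) F G W).trans ?_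
  congr 2
  ext w1 w2
  exact mul_apply₃ φ _ _ X Y Z

end Conv

namespace Twist

open Conv

variable {h : Good d cop cou} (T : Twist h) (C : Cocycle h T.hR)

lemma phiSigma_eq (X Y Z : L) :
    d.PhiSigma cop (fun x y => T.S y x) (fun x y => T.Si y x) (fun x y z => C.Φ z y x) X Y Z =
      T.PA C B Z Y X := by
  symm
  refine (mul_mul_mul_apply (ev (h := h) (A := B) X ∘ₗ ev (h := h) Y) (T.SA (Conv h B))
    (mu (T.SA B)) (emb3 h B C.Φ) (mapC h mu (mu_u T.hR) (T.SiA B) * iota h (T.SiA B) T.cent_A')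
    Z).trans ?_
  rw [PhiSigma]
  congr 2
  ext z1 z234
  congr 2
  ext z2 z34
  congr 2
  ext z3 z4
  rw [mul_iota, emb3_self]
  refine (mul_mul_mul_mul_apply (ev (h := h) (A := B) X) (T.SA (Conv h B) z1)
    (mu (T.SA B) z2) (C.Φ z3) (mapC h mu (mu_u T.hR) (T.SiA B) z4) (T.SiA B) Y).trans ?_
  congr 2
  ext y1 y2345
  congr 2
  ext y2 y345
  congr 2
  ext y3 y45
  congr 2
  ext y4 y5
  have e : T.SA (Conv h B) z1 y1 * mu (T.SA B) z2 y2 =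
      T.S (d.mul (d.s (T.S z1 y1)) (d.mul y2 z2)) :=  by
    rw [map_s]
    rfl
  rw [← mul_assoc, e]
  refine (mul_mul_mul_apply (LinearMap.id (R := k) (M := B))
    (T.S (d.mul (d.s (T.S z1 y1)) (d.mul y2 z2))) (C.Φ z3 y3)
    (mapC h mu (mu_u T.hR) (T.SiA B) z4 y4) (T.SiA B y5) X).trans ?_
  congr 2
  ext x1 x234
  congr 2
  ext x2 x34
  congr 2
  ext x3 x4
  rw [map_t, mul_assoc]
  rfl

end Twist
end CqST

namespace CqST

variable {k} {B L : Type*} [Ring B] [Algebra k B] [AddCommGroup L] [Module k L]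
variable {d : CqST k B L} {cop : L →ₗ[k] d.T2} {cou : L →ₗ[k] B}

open Conv

lemma Conv.exists_trilinear {h : Good d cop cou} (F : Conv h (Conv h (Conv h B))) :
    ∃ f : L →ₗ[k] L →ₗ[k] L →ₗ[k] B, ∀ X Y Z, f X Y Z = F Z Y X := by
  refine ⟨
    { toFun := fun X => LinearMap.mk₂ k (fun Y Z => F Z Y X) ?_ ?_ ?_ ?_
      map_add' := fun a b => ?_
      map_smul' := fun a b => ?_ }, fun X Y Z => rfl⟩
  · simp
  · simp
  · simp
  · simp
  · ext; simp
  · ext; simp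

namespace Twist

variable {h : Good d cop cou} (T : Twist h) (C : Cocycle h T.hR)

lemma apply_pr_pr {A : Type*} [Ring A] [Algebra k A] [BRing k B A] (F : Conv h A) (X Y Z : L) :
    F (T.pr X (T.pr Y Z)) = T.tmu (T.tmu F) Z Y X := by
  rw [apply_pr, apply_pr]

lemma apply_pr_pr' {A : Type*} [Ring A] [Algebra k A] [BRing k B A] (F : Conv h A) (X Y Z : L) :
    F (T.pr (T.pr X Y) Z) = mapC h T.tmu T.tmu_u (T.tmu F) Z Y X := by
  rw [apply_pr, apply_pr]
  rfl

lemma cou_pr_pr (X Y Z : L) : cou (T.pr X (T.pr Y Z)) = (1 : Conv h (Conv h (Conv h B))) Z Y X := by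
  have := T.apply_pr_pr (1 : Conv h B) X Y Z
  rwa [_root_.map_one, _root_.map_one] at this

lemma pentagon_pr (X Y Z W : L) :
    d.lift2 (fun w1 w2 => d.lift2 (fun z1 z2 => d.lift2 (fun y1 y2 => d.lift2 (fun x1 x2 =>
      T.PA C B (T.pr z1 w1) y1 x1 * T.PA C B w2 z2 (T.pr x2 y2)) (cop X)) (cop Y)) (cop Z))
      (cop W) =
    d.lift2 (fun w1 w2 => d.lift2 (fun z1 z23 => d.lift2 (fun z2 z3 =>
      d.lift2 (fun y1 y23 => d.lift2 (fun y2 y3 => d.lift2 (fun x1 x2 =>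
        T.PA C B w2 (T.pr (d.s (T.PA C B w1 z1 y1)) (T.pr y2 z2)) x1 * T.PA C B z3 y3 x2)
        (cop X)) (cop y23)) (cop Y)) (cop z23)) (cop Z)) (cop W) := by
  have e := T.pentagon_PA C
  set P := T.PA C B with hP
  have e' := congrArg (fun F => F W Z Y X) e
  refine Eq.trans ?_ (e'.trans ?_)
  · refine ((mul_apply₄ (LinearMap.id (R := k) (M := B)) (T.tmu P)
      (mapC h (mapC h T.tmu T.tmu_u) (mapC_u _ _) P) X Y Z W).trans ?_).symm
    simp only [apply_pr]
    rfl
  · refine (map_mul_apply (ev (h := h) (A := B) X ∘ₗ ev (h := h) Y ∘ₗ ev (h := h) Z) _ _ W).trans ?_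
    congr 2
    ext w1 w2
    rw [mul_iota]
    refine (mul_mul_apply (ev (h := h) (A := B) X ∘ₗ ev (h := h) Y) (T.PA C (Conv h B) w1)
      (mapC h T.tmu T.tmu_u P w2) P Z).trans ?_
    congr 2
    ext z1 z23
    congr 2
    ext z2 z3
    refine (mul_mul_apply (ev (h := h) (A := B) X) (T.PA C (Conv h B) w1 z1)
      (mapC h T.tmu T.tmu_u P w2 z2) (P z3) Y).trans ?_
    congr 2
    ext y1 y23
    congr 2
    ext y2 y3
    have e : T.PA C (Conv h B) w1 z1 y1 * mapC h T.tmu T.tmu_u P w2 z2 y2 =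
        P w2 (T.pr (d.s (P w1 z1 y1)) (T.pr y2 z2)) := by
      rw [pr_s_left, map_s, apply_pr, ← emb3_PA]
      rfl
    rw [← mul_assoc, e]
    exact map_mul_apply (LinearMap.id (R := k) (M := B)) _ _ X

lemma assoc_pr (X Y Z : L) :
    d.lift2 (fun z1 z2 => d.lift2 (fun y1 y2 => d.lift2 (fun x1 x2 =>
      T.pr (d.s (T.PA C B z1 y1 x1)) (T.pr (T.pr x2 y2) z2)) (cop X)) (cop Y)) (cop Z) =
    d.lift2 (fun z1 z2 => d.lift2 (fun y1 y2 => d.lift2 (fun x1 x2 =>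
      T.pr (d.t (T.PA C B z2 y2 x2)) (T.pr x1 (T.pr y1 z1))) (cop X)) (cop Y)) (cop Z) := by
  let := h.genRing
  have e := congrArg (fun F => exL d (F Z Y X)) (T.assoc_PA C (genL h))
  rw [← emb3_PA] at e
  refine Eq.trans ?_ (e.trans ?_)
  · refine Eq.trans ?_ (mul_apply₃ (exL d) (emb3 h _ (T.PA C B)) _ X Y Z).symm
    simp only [← apply_pr_pr', emb3_apply, ← map_s, exL_genL, pr_s_left]
  · refine (mul_apply₃ (exL d) _ (emb3 h _ (T.PA C B)) X Y Z).trans ?_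
    simp only [← apply_pr_pr, emb3_apply, ← map_t, exL_genL, pr_t_left]

lemma isCoquasi : d.IsCoquasi T.pr cop cou (fun X Y Z => T.PA C B Z Y X)
    (fun X Y Z => T.PiA C B Z Y X) := by
  refine ⟨T.pr_linear, fun X => ⟨T.one_pr X, T.pr_one X⟩, fun a b => ?_, h.s_one, fun a b => ?_,
    h.t_one, fun a b => ?_, h.coassoc, fun X => ?_, fun X => ?_, h.cop_one,
    fun X Y => (T.mulT2P_pr X Y).symm, fun b X => ?_, fun b X => ?_, fun b X => ?_, h.cou_one,
    fun b X => ?_, fun b X => ?_, fun X Y => ?_, fun X Y => ?_, exists_trilinear _,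
    fun b c X Y Z => ?_, fun b c X Y Z => ?_, fun b c X Y Z => ?_, fun X Y => ⟨?_, ?_⟩,
    fun b X Y Z => ?_, T.pentagon_pr C, T.assoc_pr C, exists_trilinear _, fun X Y Z => ?_,
    fun X Y Z => ?_⟩
  · rw [pr_s_left, h.s_mul]
  · rw [pr_t_left]
    simpa [h.mul_one] using h.t_t a b d.one
  · rw [pr_s_left, pr_t_left]
    simpa [h.mul_one] using h.s_t a b d.one
  · simpa only [pr_s_left] using h.cou_s X
  · simpa only [pr_t_left] using h.cou_t X
  · simpa only [pr_s, pr_t] using h.takeuchi b X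
  · simpa only [pr_s_left] using h.cop_s b X
  · simpa only [pr_t_left] using h.cop_t b X
  · rw [pr_s_left, h.cou_s_mul]
  · rw [pr_t_left, h.cou_t_mul]
  · rw [pr_s, cou_pr, h.cou_mul_s]
  · rw [pr_t, cou_pr, h.cou_mul_t]
  · beta_reduce
    rw [pr_s_left, pr_t_left, map_s, map_t, u_self, u_self, mul_assoc]
  · beta_reduce
    rw [pr_s, pr_t, pr_s_left, pr_t_left, map_s, map_t, u_mul, mul_u]
  · beta_reduce
    rw [pr_s, pr_t, pr_s_left, pr_t_left, map_s, map_t, u_mul, mul_u]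
  · have := DFunLike.congr_fun (DFunLike.congr_fun (T.norm_left_PA C) Y) X
    refine this.trans ?_
    rw [cou_pr, ← h.cou_mul_s]
    rfl
  · have := DFunLike.congr_fun (DFunLike.congr_fun (T.norm_mid_PA C) Y) X
    refine this.trans ?_
    rw [cou_pr, ← h.cou_mul_s]
    rfl
  · beta_reduce
    rw [pr_s, pr_t, (cent_iff _).1 (T.cent_PA C)]
  · refine Eq.trans ?_ (T.cou_pr_pr X Y Z).symm
    rw [← T.PA_mul_PiA C]
    exact (mul_apply₃ (LinearMap.id (R := k) (M := B)) _ _ X Y Z).symm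
  · refine Eq.trans ?_ (T.cou_pr_pr X Y Z).symm
    rw [← T.PiA_mul_PA C]
    exact (mul_apply₃ (LinearMap.id (R := k) (M := B)) _ _ X Y Z).symm

end Twist
end CqST

namespace CqST

variable {k} {B L : Type*} [Ring B] [Algebra k B] [AddCommGroup L] [Module k L]

/-- The axioms on `(L, cop, cou)` in a coquasi-bialgebroid which do not involve the cocycle. -/
structure Weak (d : CqST k B L) (cop : L →ₗ[k] d.T2) (cou : L →ₗ[k] B) : Prop where
  one_mul : ∀ X, d.mul d.one X = X
  mul_one : ∀ X, d.mul X d.one = X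
  s_mul : ∀ a b, d.mul (d.s a) (d.s b) = d.s (a * b)
  s_one : d.s 1 = d.one
  t_mul : ∀ a b, d.mul (d.t a) (d.t b) = d.t (b * a)
  t_one : d.t 1 = d.one
  coassoc : ∀ X, d.lift2 (fun x1 x2 => d.lift2 (fun y1 y2 => d.mk3 x1 y1 y2) (cop x2)) (cop X) =
    d.lift2 (fun x12 x3 => d.lift2 (fun x1 x2 => d.mk3 x1 x2 x3) (cop x12)) (cop X)
  cou_s : ∀ X, d.lift2 (fun x1 x2 => d.mul (d.s (cou x1)) x2) (cop X) = X
  cou_t : ∀ X, d.lift2 (fun x1 x2 => d.mul (d.t (cou x2)) x1) (cop X) = X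
  cop_one : cop d.one = d.mk2 d.one d.one
  cop_mul : ∀ X Y, cop (d.mul X Y) = d.mulT2P (fun X Y => d.mul X Y) (cop X) (cop Y)
  takeuchi : ∀ b X, d.lift2 (fun x y => d.mk2 (d.mul x (d.t b)) y) (cop X) =
    d.lift2 (fun x y => d.mk2 x (d.mul y (d.s b))) (cop X)
  cop_s : ∀ b X, cop (d.mul (d.s b) X) = d.lift2 (fun x y => d.mk2 (d.mul (d.s b) x) y) (cop X)
  cop_t : ∀ b X, cop (d.mul (d.t b) X) = d.lift2 (fun x y => d.mk2 x (d.mul (d.t b) y)) (cop X)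
  cou_one : cou d.one = 1
  cou_s_mul : ∀ b X, cou (d.mul (d.s b) X) = b * cou X
  cou_t_mul : ∀ b X, cou (d.mul (d.t b) X) = cou X * b
  cou_mul_s : ∀ X Y, cou (d.mul X (d.s (cou Y))) = cou (d.mul X Y)
  cou_mul_t : ∀ X Y, cou (d.mul X (d.t (cou Y))) = cou (d.mul X Y)

variable {d : CqST k B L} {cop : L →ₗ[k] d.T2} {cou : L →ₗ[k] B}

/-- The factorwise product on `L ⊗ L`. -/
def star (d : CqST k B L) : L ⊗[k] L →ₗ[k] L ⊗[k] L →ₗ[k] L ⊗[k] L :=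
  TensorProduct.lift
    ((TensorProduct.mapBilinear (RingHom.id k) L L L L).compl₁₂ d.mul d.mul)

@[simp] lemma star_tmul (x1 x2 y1 y2 : L) :
    d.star (x1 ⊗ₜ y1) (x2 ⊗ₜ y2) = d.mul x1 x2 ⊗ₜ d.mul y1 y2 := by simp [star]

lemma tlift_eq_star (z w : L ⊗[k] L) :
    tlift k (fun x1 x2 => tlift k (fun y1 y2 => d.mul x1 y1 ⊗ₜ[k] d.mul x2 y2) w) z =
      d.star z w := by
  have e1 : ∀ x1 x2, tlift k (fun y1 y2 => d.mul x1 y1 ⊗ₜ[k] d.mul x2 y2) =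
      TensorProduct.map (d.mul x1) (d.mul x2) := fun x1 x2 =>
    tlift_tmul ((TensorProduct.mk k L L).compl₁₂ (d.mul x1) (d.mul x2))
  simp only [e1]
  have e2 : tlift k (fun x1 x2 => TensorProduct.map (d.mul x1) (d.mul x2) w) =
      LinearMap.applyₗ w ∘ₗ d.star :=
    (tlift_tmul ((TensorProduct.mapBilinear (RingHom.id k) L L L L).compl₁₂ d.mul d.mul |>.compr₂
      (LinearMap.applyₗ w))).trans (TensorProduct.ext' fun x y => by simp [star])
  rw [e2]
  rfl

namespace Weak

variable (h : Weak d cop cou)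

/-- The linear map `x ⊗ y ↦ t (cou y) x` on representatives. -/
def tau (_ : Weak d cop cou) : L ⊗[k] L →ₗ[k] L :=
  TensorProduct.lift ((d.mul ∘ₗ d.t ∘ₗ cou).flip)

lemma tau_tmul (x y : L) : h.tau (x ⊗ₜ y) = d.mul (d.t (cou y)) x := rfl

/-- The linear map `x ⊗ y ↦ s (cou x) y` on representatives. -/
def sigma (_ : Weak d cop cou) : L ⊗[k] L →ₗ[k] L :=
  TensorProduct.lift (d.mul ∘ₗ d.s ∘ₗ cou)

lemma sigma_tmul (x y : L) : h.sigma (x ⊗ₜ y) = d.mul (d.s (cou x)) y := rfl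

lemma cou_s_self (h : Weak d cop cou) (a : B) : cou (d.s a) = a := by
  simpa [h.mul_one, h.cou_one] using h.cou_s_mul a d.one

lemma one_ne_zero (h : Weak d cop cou) [Nontrivial L] : d.one ≠ 0 := by
  obtain ⟨X, hX⟩ := exists_ne (0 : L)
  intro e
  exact hX (by rw [← h.one_mul X, e, map_zero, LinearMap.zero_apply])

lemma cop_ne_zero (h : Weak d cop cou) {X : L} (hX : X ≠ 0) : cop X ≠ 0 := fun e =>
  hX (by rw [← h.cou_t X, e, map_zero])

lemma bal_cou_s (h : Weak d cop cou) [Nontrivial L] : d.Bal fun x y => d.mul (d.s (cou x)) y :=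
  bal_of_lift2_ne_zero (z := cop d.one) (by rw [h.cou_s]; exact h.one_ne_zero)

lemma bal_cou_t (h : Weak d cop cou) [Nontrivial L] : d.Bal fun x y => d.mul (d.t (cou y)) x :=
  bal_of_lift2_ne_zero (z := cop d.one) (by rw [h.cou_t]; exact h.one_ne_zero)

lemma bal_cop_s (h : Weak d cop cou) (b : B) : d.Bal fun x y => d.mk2 (d.mul (d.s b) x) y := by
  by_contra hb
  refine hb ⟨0, fun x y => ?_⟩
  have : d.mul (d.s b) x = 0 := by
    by_contra hx
    exact h.cop_ne_zero hx (by rw [h.cop_s, lift2_of_not_bal hb]; rfl)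
  simp [this, mk2]

lemma bal_cop_t (h : Weak d cop cou) (b : B) : d.Bal fun x y => d.mk2 x (d.mul (d.t b) y) := by
  by_contra hb
  refine hb ⟨0, fun x y => ?_⟩
  have : d.mul (d.t b) y = 0 := by
    by_contra hx
    exact h.cop_ne_zero hx (by rw [h.cop_t, lift2_of_not_bal hb]; rfl)
  simp [this, mk2]

lemma star_well_defined (h : Weak d cop cou) {X Y : L} (hXY : d.mul X Y ≠ 0) {z z' w w' : L ⊗[k] L}
    (hz : d.rel.mkQ z = cop X) (hz' : d.rel.mkQ z' = cop X) (hw : d.rel.mkQ w = cop Y)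
    (hw' : d.rel.mkQ w' = cop Y) : d.rel.mkQ (d.star z w) = d.rel.mkQ (d.star z' w') := by
  have e := h.cop_mul X Y
  have hne := h.cop_ne_zero hXY
  unfold mulT2P at e
  simp only [tlift_eq_star] at e
  split_ifs at e with hex
  · exact (hex.choose_spec z w hz hw).trans (hex.choose_spec z' w' hz' hw').symm
  · exact absurd e hne

lemma star_rel_of_ne (h : Weak d cop cou)
    {X : L} (hX : X ≠ 0) {z r : L ⊗[k] L} (hz : d.rel.mkQ z = cop X)
    (hr : r ∈ d.rel) : d.star z r ∈ d.rel := by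
  obtain ⟨w, hw⟩ := d.rel.mkQ_surjective (cop d.one)
  have hr' : d.rel.mkQ r = 0 := by simpa using hr
  have := h.star_well_defined (Y := d.one) (by rwa [h.mul_one]) hz hz hw (w' := w + r)
    (by rw [map_add, hw, hr', add_zero])
  rw [map_add, map_add, left_eq_add] at this
  simpa using this

lemma rel_star_of_ne (h : Weak d cop cou)
    {Y : L} (hY : Y ≠ 0) {w r : L ⊗[k] L} (hw : d.rel.mkQ w = cop Y)
    (hr : r ∈ d.rel) : d.star r w ∈ d.rel := by
  obtain ⟨z, hz⟩ := d.rel.mkQ_surjective (cop d.one)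
  have hr' : d.rel.mkQ r = 0 := by simpa using hr
  have := h.star_well_defined (X := d.one) (by rwa [h.one_mul]) hz (z' := z + r)
    (by rw [map_add, hz, hr', add_zero]) hw hw
  rw [map_add, LinearMap.add_apply, map_add, left_eq_add] at this
  simpa using this

lemma mkQ_lTensor_t (h : Weak d cop cou) {X : L} {z : L ⊗[k] L} (hz : d.rel.mkQ z = cop X) (a : B) :
    d.rel.mkQ (TensorProduct.map LinearMap.id (d.mul (d.t a)) z) = cop (d.mul (d.t a) X) := by
  rw [h.cop_t, ← hz]
  refine LinearMap.congr_fun (f := d.rel.mkQ ∘ₗ TensorProduct.map LinearMap.id (d.mul (d.t a)))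
    (g := d.lift2 (fun x y => d.mk2 x (d.mul (d.t a) y)) ∘ₗ d.rel.mkQ)
    (TensorProduct.ext' fun x y => ?_) z
  exact ((h.bal_cop_t a).lift2_mk2 x y).symm

lemma mkQ_rTensor_s (h : Weak d cop cou) {X : L} {z : L ⊗[k] L} (hz : d.rel.mkQ z = cop X) (a : B) :
    d.rel.mkQ (TensorProduct.map (d.mul (d.s a)) LinearMap.id z) = cop (d.mul (d.s a) X) := by
  rw [h.cop_s, ← hz]
  refine LinearMap.congr_fun (f := d.rel.mkQ ∘ₗ TensorProduct.map (d.mul (d.s a)) LinearMap.id)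
    (g := d.lift2 (fun x y => d.mk2 (d.mul (d.s a) x) y) ∘ₗ d.rel.mkQ)
    (TensorProduct.ext' fun x y => ?_) z
  exact ((h.bal_cop_s a).lift2_mk2 x y).symm

lemma mkQ_one_t (h : Weak d cop cou) (a : B) : d.rel.mkQ (d.one ⊗ₜ d.t a) = cop (d.t a) := by
  have := h.cop_t a d.one
  rw [h.mul_one, h.cop_one, (h.bal_cop_t a).lift2_mk2, h.mul_one] at this
  exact this.symm

lemma mkQ_s_one (h : Weak d cop cou) (a : B) : d.rel.mkQ (d.s a ⊗ₜ d.one) = cop (d.s a) := by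
  have := h.cop_s a d.one
  rw [h.mul_one, h.cop_one, (h.bal_cop_s a).lift2_mk2, h.mul_one] at this
  exact this.symm

variable [Nontrivial L]

lemma s_s (h : Weak d cop cou)
    (a b : B) (X : L) : d.mul (d.s a) (d.mul (d.s b) X) = d.mul (d.s (a * b)) X := by
  have := h.bal_cou_s.apply_eq b (d.s a) X
  rwa [h.cou_t_mul, h.cou_s_self, eq_comm] at this

lemma t_t (h : Weak d cop cou)
    (a b : B) (X : L) : d.mul (d.t a) (d.mul (d.t b) X) = d.mul (d.t (b * a)) X := by
  have := h.bal_cou_t.apply_eq b X (d.s a)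
  rwa [h.cou_s_mul, h.cou_s_self] at this

lemma s_t (h : Weak d cop cou) (a b : B) (X : L) :
    d.mul (d.s a) (d.mul (d.t b) X) = d.mul (d.t b) (d.mul (d.s a) X) := by
  have := (h.bal_cop_s a).apply_eq b X d.one
  rw [← mk2_bal] at this
  have := congrArg (d.lift2 fun x y => d.mul (d.t (cou y)) x) this
  rwa [h.bal_cou_t.lift2_mk2, h.bal_cou_t.lift2_mk2, h.cou_one, h.t_one, h.one_mul,
    h.one_mul] at this

lemma star_rel (h : Weak d cop cou)
    {X : L} {z r : L ⊗[k] L} (hz : d.rel.mkQ z = cop X) (hr : r ∈ d.rel) :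
    d.star z r ∈ d.rel := by
  by_cases hX : X = 0
  · obtain ⟨z1, hz1⟩ := d.rel.mkQ_surjective (cop d.one)
    have h1 := h.star_rel_of_ne h.one_ne_zero hz1 hr
    have h2 := h.star_rel_of_ne h.one_ne_zero (z := z + z1)
      (by rw [map_add, hz, hX, map_zero, hz1, zero_add]) hr
    rw [map_add, LinearMap.add_apply] at h2
    exact (Submodule.add_mem_iff_left _ h1).1 h2
  · exact h.star_rel_of_ne hX hz hr

lemma rel_star (h : Weak d cop cou)
    {Y : L} {w r : L ⊗[k] L} (hw : d.rel.mkQ w = cop Y) (hr : r ∈ d.rel) :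
    d.star r w ∈ d.rel := by
  by_cases hY : Y = 0
  · obtain ⟨w1, hw1⟩ := d.rel.mkQ_surjective (cop d.one)
    have h1 := h.rel_star_of_ne h.one_ne_zero hw1 hr
    have h2 := h.rel_star_of_ne h.one_ne_zero (w := w + w1)
      (by rw [map_add, hw, hY, map_zero, hw1, zero_add]) hr
    rw [map_add] at h2
    exact (Submodule.add_mem_iff_left _ h1).1 h2
  · exact h.rel_star_of_ne hY hw hr

lemma cop_mul_star (h : Weak d cop cou) {X Y : L} {z w : L ⊗[k] L} (hz : d.rel.mkQ z = cop X)
    (hw : d.rel.mkQ w = cop Y) : cop (d.mul X Y) = d.rel.mkQ (d.star z w) := by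
  have e := h.cop_mul X Y
  unfold mulT2P at e
  simp only [tlift_eq_star] at e
  have hex : ∃ u : d.T2, ∀ zr wr : L ⊗[k] L, Submodule.Quotient.mk zr = cop X →
      Submodule.Quotient.mk wr = cop Y → Submodule.Quotient.mk (d.star zr wr) = u := by
    refine ⟨_, fun z' w' hz' hw' => sub_eq_zero.1 (?_ : _ - d.rel.mkQ (d.star z w) = 0)⟩
    have e1 := h.star_rel hz (r := w' - w)
      (by rw [← d.rel.ker_mkQ, LinearMap.mem_ker, map_sub, hw]; exact sub_eq_zero.2 hw')
    have e2 := h.rel_star hw' (r := z' - z)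
      (by rw [← d.rel.ker_mkQ, LinearMap.mem_ker, map_sub, hz]; exact sub_eq_zero.2 hz')
    have e3 := d.rel.add_mem e1 e2
    rw [map_sub, map_sub, LinearMap.sub_apply, sub_add_sub_cancel',
      ← d.rel.ker_mkQ, LinearMap.mem_ker, map_sub] at e3
    exact e3
  rw [dif_pos hex] at e
  rw [e]
  exact (hex.choose_spec z w hz hw).symm

lemma tau_eq (z : L ⊗[k] L) :
    h.tau z = d.lift2 (fun x y => d.mul (d.t (cou y)) x) (d.rel.mkQ z) := by
  induction z using TensorProduct.induction_on with
  | zero => simp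
  | add z z' h1 h2 => rw [map_add, map_add, map_add, h1, h2]
  | tmul x y => exact (h.bal_cou_t.lift2_mk2 x y).symm

lemma tau_cop {X : L} {z : L ⊗[k] L} (hz : d.rel.mkQ z = cop X) : h.tau z = X := by
  rw [tau_eq, hz, h.cou_t]

lemma tau_eq_of_rel {z w : L ⊗[k] L} (hz : z - w ∈ d.rel) : h.tau z = h.tau w := by
  have e : d.rel.mkQ z = d.rel.mkQ w := (Submodule.Quotient.eq d.rel).2 hz
  rw [tau_eq, tau_eq, e]

lemma sigma_eq (z : L ⊗[k] L) :
    h.sigma z = d.lift2 (fun x y => d.mul (d.s (cou x)) y) (d.rel.mkQ z) := by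
  induction z using TensorProduct.induction_on with
  | zero => simp
  | add z z' h1 h2 => rw [map_add, map_add, map_add, h1, h2]
  | tmul x y => exact (h.bal_cou_s.lift2_mk2 x y).symm

lemma sigma_cop {X : L} {z : L ⊗[k] L} (hz : d.rel.mkQ z = cop X) : h.sigma z = X := by
  rw [sigma_eq, hz, h.cou_s]

lemma sigma_eq_of_rel {z w : L ⊗[k] L} (hz : z - w ∈ d.rel) : h.sigma z = h.sigma w := by
  have e : d.rel.mkQ z = d.rel.mkQ w := (Submodule.Quotient.eq d.rel).2 hz
  rw [sigma_eq, sigma_eq, e]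

lemma star_slide (h : Weak d cop cou)
    {X : L} {z : L ⊗[k] L} (hz : d.rel.mkQ z = cop X) (a : B) (x y : L) :
    d.star z (d.mul (d.t a) x ⊗ₜ y) - d.star z (x ⊗ₜ d.mul (d.s a) y) ∈ d.rel := by
  rw [← map_sub]
  exact h.star_rel hz (Submodule.subset_span ⟨a, x, y, rfl⟩)

lemma tau_star_slide {X : L} {z : L ⊗[k] L} (hz : d.rel.mkQ z = cop X) (a : B) (Y : L) :
    h.tau (d.star z (Y ⊗ₜ d.s a)) = h.tau (d.star z (d.mul (d.t a) Y ⊗ₜ d.one)) := by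
  have := h.tau_eq_of_rel (h.star_slide hz a Y d.one)
  rw [h.mul_one] at this
  exact this.symm

lemma sigma_star_slide {X : L} {z : L ⊗[k] L} (hz : d.rel.mkQ z = cop X) (a : B) (Y : L) :
    h.sigma (d.star z (d.t a ⊗ₜ Y)) = h.sigma (d.star z (d.one ⊗ₜ d.mul (d.s a) Y)) := by
  have := h.sigma_eq_of_rel (h.star_slide hz a d.one Y)
  rwa [h.mul_one] at this

lemma mul_eq_tau {X : L} {z : L ⊗[k] L} (hz : d.rel.mkQ z = cop X) (Y : L) :
    d.mul X Y = h.tau (d.star z (Y ⊗ₜ d.one)) := by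
  have key : ∀ w, h.tau (d.star z w) = h.tau (d.star z (h.tau w ⊗ₜ d.one)) := fun w => by
    induction w using TensorProduct.induction_on with
    | zero => simp
    | add w w' h1 h2 => simp only [map_add, TensorProduct.add_tmul, h1, h2]
    | tmul y1 y2 =>
      rw [tau_tmul, ← h.tau_star_slide hz]
      refine LinearMap.congr_fun (f := h.tau ∘ₗ d.star.flip (y1 ⊗ₜ y2))
        (g := h.tau ∘ₗ d.star.flip (y1 ⊗ₜ d.s (cou y2))) (TensorProduct.ext' fun x1 x2 => ?_) z
      simp [tau_tmul, h.cou_mul_s]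
  obtain ⟨w, hw⟩ := d.rel.mkQ_surjective (cop Y)
  rw [← h.tau_cop (h.cop_mul_star hz hw).symm, key, h.tau_cop hw]

lemma mul_eq_sigma {X : L} {z : L ⊗[k] L} (hz : d.rel.mkQ z = cop X) (Y : L) :
    d.mul X Y = h.sigma (d.star z (d.one ⊗ₜ Y)) := by
  have key : ∀ w, h.sigma (d.star z w) = h.sigma (d.star z (d.one ⊗ₜ h.sigma w)) := fun w => by
    induction w using TensorProduct.induction_on with
    | zero => simp
    | add w w' h1 h2 => simp only [map_add, TensorProduct.tmul_add, h1, h2]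
    | tmul y1 y2 =>
      rw [sigma_tmul, ← h.sigma_star_slide hz]
      refine LinearMap.congr_fun (f := h.sigma ∘ₗ d.star.flip (y1 ⊗ₜ y2))
        (g := h.sigma ∘ₗ d.star.flip (d.t (cou y1) ⊗ₜ y2)) (TensorProduct.ext' fun x1 x2 => ?_) z
      simp [sigma_tmul, h.cou_mul_t]
  obtain ⟨w, hw⟩ := d.rel.mkQ_surjective (cop Y)
  rw [← h.sigma_cop (h.cop_mul_star hz hw).symm, key, h.sigma_cop hw]

lemma t_assoc (h : Weak d cop cou) (a : B) (X Y : L) :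
    d.mul (d.mul (d.t a) X) Y = d.mul (d.t a) (d.mul X Y) := by
  obtain ⟨z, hz⟩ := d.rel.mkQ_surjective (cop X)
  rw [h.mul_eq_tau (h.mkQ_lTensor_t hz a), h.mul_eq_tau hz]
  refine LinearMap.congr_fun (f := h.tau ∘ₗ d.star.flip (Y ⊗ₜ d.one) ∘ₗ
      TensorProduct.map LinearMap.id (d.mul (d.t a)))
    (g := d.mul (d.t a) ∘ₗ h.tau ∘ₗ d.star.flip (Y ⊗ₜ d.one))
    (TensorProduct.ext' fun x y => ?_) z
  simp [tau_tmul, h.mul_one, h.cou_t_mul, h.t_t]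

lemma s_assoc (h : Weak d cop cou) (a : B) (X Y : L) :
    d.mul (d.mul (d.s a) X) Y = d.mul (d.s a) (d.mul X Y) := by
  obtain ⟨z, hz⟩ := d.rel.mkQ_surjective (cop X)
  rw [h.mul_eq_sigma (h.mkQ_rTensor_s hz a), h.mul_eq_sigma hz]
  refine LinearMap.congr_fun (f := h.sigma ∘ₗ d.star.flip (d.one ⊗ₜ Y) ∘ₗ
      TensorProduct.map (d.mul (d.s a)) LinearMap.id)
    (g := d.mul (d.s a) ∘ₗ h.sigma ∘ₗ d.star.flip (d.one ⊗ₜ Y))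
    (TensorProduct.ext' fun x y => ?_) z
  simp [sigma_tmul, h.mul_one, h.cou_s_mul, h.s_s]

lemma mid_t (h : Weak d cop cou) (a : B) (X Y : L) :
    d.mul (d.mul X (d.t a)) Y = d.mul X (d.mul (d.t a) Y) := by
  obtain ⟨z, hz⟩ := d.rel.mkQ_surjective (cop X)
  rw [h.mul_eq_tau (h.cop_mul_star hz (h.mkQ_one_t a)).symm, h.mul_eq_tau hz,
    ← h.tau_star_slide hz]
  refine LinearMap.congr_fun (f := h.tau ∘ₗ d.star.flip (Y ⊗ₜ d.one) ∘ₗ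
      d.star.flip (d.one ⊗ₜ d.t a))
    (g := h.tau ∘ₗ d.star.flip (Y ⊗ₜ d.s a))
    (TensorProduct.ext' fun x y => ?_) z
  have := h.cou_mul_t y (d.s a)
  rw [h.cou_s_self] at this
  simp [tau_tmul, h.mul_one, this]

lemma mid_s (h : Weak d cop cou) (a : B) (X Y : L) :
    d.mul (d.mul X (d.s a)) Y = d.mul X (d.mul (d.s a) Y) := by
  obtain ⟨z, hz⟩ := d.rel.mkQ_surjective (cop X)
  rw [h.mul_eq_sigma (h.cop_mul_star hz (h.mkQ_s_one a)).symm, h.mul_eq_sigma hz,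
    ← h.sigma_star_slide hz]
  refine LinearMap.congr_fun (f := h.sigma ∘ₗ d.star.flip (d.one ⊗ₜ Y) ∘ₗ
      d.star.flip (d.s a ⊗ₜ d.one))
    (g := h.sigma ∘ₗ d.star.flip (d.t a ⊗ₜ Y))
    (TensorProduct.ext' fun x y => ?_) z
  have := h.cou_mul_t x (d.s a)
  rw [h.cou_s_self] at this
  simp [sigma_tmul, h.mul_one, this]

lemma lift2_star (h : Weak d cop cou) (z : L ⊗[k] L) (y1 y2 : L) :
    d.lift2 (fun x1 x2 => d.mk2 (d.mul x1 y1) (d.mul x2 y2)) (d.rel.mkQ z) =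
      d.rel.mkQ (d.star z (y1 ⊗ₜ y2)) := by
  have hb : d.Bal fun x1 x2 => d.mk2 (d.mul x1 y1) (d.mul x2 y2) :=
    Bal.of_linear (d.mk2L.compl₁₂ (d.mul.flip y1) (d.mul.flip y2)) fun a x y => by
      simp [h.t_assoc, h.s_assoc, mk2_bal]
  refine LinearMap.congr_fun
    (f := d.lift2 (fun x1 x2 => d.mk2 (d.mul x1 y1) (d.mul x2 y2)) ∘ₗ d.rel.mkQ)
    (g := d.rel.mkQ ∘ₗ d.star.flip (y1 ⊗ₜ y2)) (TensorProduct.ext' fun x1 x2 => ?_) z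
  refine (hb.lift2_mk2 x1 x2).trans ?_
  simp [mk2]

lemma cop_mul_lift (h : Weak d cop cou)
    (X Y : L) : cop (d.mul X Y) = d.lift2 (fun y1 y2 => d.lift2 (fun x1 x2 =>
    d.mk2 (d.mul x1 y1) (d.mul x2 y2)) (cop X)) (cop Y) := by
  obtain ⟨z, hz⟩ := d.rel.mkQ_surjective (cop X)
  obtain ⟨w, hw⟩ := d.rel.mkQ_surjective (cop Y)
  rw [h.cop_mul_star hz hw, ← hw]
  simp only [← hz, h.lift2_star]
  have hb : d.Bal fun y1 y2 => d.rel.mkQ (d.star z (y1 ⊗ₜ y2)) :=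
    Bal.of_linear ((TensorProduct.mk k L L).compr₂ (d.rel.mkQ ∘ₗ d.star z)) fun a x y =>
      (Submodule.Quotient.eq d.rel).2 (h.star_slide hz a x y)
  refine LinearMap.congr_fun (f := d.rel.mkQ ∘ₗ d.star z)
    (g := d.lift2 (fun y1 y2 => d.rel.mkQ (d.star z (y1 ⊗ₜ y2))) ∘ₗ d.rel.mkQ)
    (TensorProduct.ext' fun y1 y2 => ?_) w
  exact (hb.lift2_mk2 y1 y2).symm

lemma good (h : Weak d cop cou) : Good d cop cou where
  one_mul := h.one_mul
  mul_one := h.mul_one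
  s_one := h.s_one
  t_one := h.t_one
  s_s := h.s_s
  t_t := h.t_t
  s_t := h.s_t
  s_assoc := h.s_assoc
  t_assoc := h.t_assoc
  mid_s := h.mid_s
  mid_t := h.mid_t
  coassoc := h.coassoc
  cou_s := h.cou_s
  cou_t := h.cou_t
  cop_one := h.cop_one
  cop_mul := h.cop_mul_lift
  takeuchi := h.takeuchi
  cop_s := h.cop_s
  cop_t := h.cop_t
  cou_one := h.cou_one
  cou_s_mul := h.cou_s_mul
  cou_t_mul := h.cou_t_mul
  cou_mul_s := h.cou_mul_s
  cou_mul_t := h.cou_mul_t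

end Weak
end CqST

namespace CqST

variable {k} {B L : Type*} [Ring B] [Algebra k B] [AddCommGroup L] [Module k L]
variable {d : CqST k B L} {cop : L →ₗ[k] d.T2} {cou : L →ₗ[k] B}

open Conv

lemma span_eq_top_of_ne_zero {M N : Type*} [AddCommGroup M] [Module k M] [AddCommGroup N]
    [Module k N] (f : M →ₗ[k] N) {m₀ : M} (hm₀ : f m₀ ≠ 0) {S : Set M}
    (hS : ∀ m, f m ≠ 0 → m ∈ S) : Submodule.span k S = ⊤ := by
  refine Submodule.eq_top_iff'.2 fun m => ?_
  by_cases hm : f m = 0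
  · have h1 := Submodule.subset_span (R := k) (hS (m + m₀) (by rwa [map_add, hm, zero_add]))
    exact (Submodule.add_mem_iff_left _ (Submodule.subset_span (hS m₀ hm₀))).1 h1
  · exact Submodule.subset_span (hS m hm)

lemma span_lift2_eq_top {Q : Type*} [AddCommGroup Q] [Module k Q] {f : L → L → Q}
    (hcop : cop d.one = d.mk2 d.one d.one) (hf : d.lift2 f (cop d.one) ≠ 0) :
    Submodule.span k {x | f d.one x ≠ 0} = ⊤ := by
  have hb := bal_of_lift2_ne_zero hf
  obtain ⟨f', hf'⟩ := hb.exists_linear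
  rw [hcop, hb.lift2_mk2] at hf
  exact span_eq_top_of_ne_zero (f' d.one) (m₀ := d.one) (by rwa [hf']) fun x hx => by
    rwa [hf'] at hx

lemma span_lift2_eq_top' {Q : Type*} [AddCommGroup Q] [Module k Q] {f : L → L → Q}
    (hcop : cop d.one = d.mk2 d.one d.one) (hf : d.lift2 f (cop d.one) ≠ 0) :
    Submodule.span k {x | f x d.one ≠ 0} = ⊤ := by
  have hb := bal_of_lift2_ne_zero hf
  obtain ⟨f', hf'⟩ := hb.exists_linear
  rw [hcop, hb.lift2_mk2] at hf
  exact span_eq_top_of_ne_zero (f'.flip d.one) (m₀ := d.one) (by rwa [LinearMap.flip_apply, hf'])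
    fun x hx => by rwa [LinearMap.flip_apply, hf'] at hx

section Inverse

variable {h : Good d cop cou} {P : Type*} [AddCommGroup P] [Module k P]

lemma Good.span_cou_ne_zero (h : Good d cop cou) [Nontrivial B] :
    Submodule.span k {X | cou X ≠ 0} = ⊤ :=
  span_eq_top_of_ne_zero cou (m₀ := d.one) (by rw [h.cou_one]; exact one_ne_zero) fun _ hX => hX

lemma inv_s_left {F : Conv h (Conv h B)} (hF : F d.one = 1) (g : P →ₗ[k] L →ₗ[k] L →ₗ[k] B)
    (H : Submodule.span k {p | d.conv2P cop (fun x y => F y x) (fun x y => g p x y)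
      d.one d.one ≠ 0} = ⊤) (p : P) (a : B) (x y : L) :
    g p (d.mul (d.s a) x) y = a * g p x y := by
  refine LinearMap.congr_fun (f := LinearMap.applyₗ y ∘ₗ LinearMap.applyₗ (d.mul (d.s a) x) ∘ₗ g)
    (g := LinearMap.mulLeft k a ∘ₗ LinearMap.applyₗ y ∘ₗ LinearMap.applyₗ x ∘ₗ g)
    (LinearMap.ext_on H fun p hp => ?_) p
  refine LinearMap.congr_fun (f := g p (d.mul (d.s a) x)) (g := LinearMap.mulLeft k a ∘ₗ g p x)
    (LinearMap.ext_on (span_lift2_eq_top h.cop_one hp) fun y hy => ?_) y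
  have := (bal_of_lift2_ne_zero hy).apply_eq a d.one x
  simpa [hF, map_t, one_apply, h.cou_one, h.cou_t_mul] using this.symm

lemma inv_t_left {F : Conv h (Conv h B)} (hF : F d.one = 1) (g : P →ₗ[k] L →ₗ[k] L →ₗ[k] B)
    (H : Submodule.span k {p | d.conv2P cop (fun x y => g p x y) (fun x y => F y x)
      d.one d.one ≠ 0} = ⊤) (p : P) (a : B) (x y : L) :
    g p (d.mul (d.t a) x) y = g p x y * a := by
  refine LinearMap.congr_fun (f := LinearMap.applyₗ y ∘ₗ LinearMap.applyₗ (d.mul (d.t a) x) ∘ₗ g)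
    (g := LinearMap.mulRight k a ∘ₗ LinearMap.applyₗ y ∘ₗ LinearMap.applyₗ x ∘ₗ g)
    (LinearMap.ext_on H fun p hp => ?_) p
  refine LinearMap.congr_fun (f := g p (d.mul (d.t a) x)) (g := LinearMap.mulRight k a ∘ₗ g p x)
    (LinearMap.ext_on (span_lift2_eq_top' h.cop_one hp) fun y hy => ?_) y
  have := (bal_of_lift2_ne_zero hy).apply_eq a x d.one
  simpa [hF, map_s, one_apply, h.cou_one, h.cou_s_mul] using this

lemma inv_s_right [Nontrivial B] {F : Conv h (Conv h B)} (hF : F d.one = 1)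
    (G : P →ₗ[k] L →ₗ[k] Conv h B)
    (H : ∀ X, cou X ≠ 0 → Submodule.span k {p | d.conv2P cop (fun x y => F y x)
      (fun x y => G p y x) X d.one ≠ 0} = ⊤) (p : P) (a : B) (y : L) :
    G p (d.mul (d.s a) y) = u k a * G p y := by
  ext X
  refine LinearMap.congr_fun (f := lin (G p (d.mul (d.s a) y))) (g := lin (u k a * G p y))
    (LinearMap.ext_on h.span_cou_ne_zero fun X hX => ?_) X
  refine LinearMap.congr_fun (f := ev X ∘ₗ LinearMap.applyₗ (d.mul (d.s a) y) ∘ₗ G)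
    (g := ev X ∘ₗ LinearMap.mulLeft k (u k a) ∘ₗ LinearMap.applyₗ y ∘ₗ G)
    (LinearMap.ext_on (H X hX) fun p hp => ?_) p
  have := (bal_of_lift2_ne_zero (f := fun y1 y2 => (F y1 * G p y2) X) hp).apply_eq a d.one y
  simpa [hF, map_t] using this.symm

lemma inv_t_right [Nontrivial B] {F : Conv h (Conv h B)} (hF : F d.one = 1)
    (G : P →ₗ[k] L →ₗ[k] Conv h B)
    (H : ∀ X, cou X ≠ 0 → Submodule.span k {p | d.conv2P cop (fun x y => G p y x)
      (fun x y => F y x) X d.one ≠ 0} = ⊤) (p : P) (a : B) (y : L) :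
    G p (d.mul (d.t a) y) = G p y * u k a := by
  ext X
  refine LinearMap.congr_fun (f := lin (G p (d.mul (d.t a) y))) (g := lin (G p y * u k a))
    (LinearMap.ext_on h.span_cou_ne_zero fun X hX => ?_) X
  refine LinearMap.congr_fun (f := ev X ∘ₗ LinearMap.applyₗ (d.mul (d.t a) y) ∘ₗ G)
    (g := ev X ∘ₗ LinearMap.mulRight k (u k a) ∘ₗ LinearMap.applyₗ y ∘ₗ G)
    (LinearMap.ext_on (H X hX) fun p hp => ?_) p
  have := (bal_of_lift2_ne_zero (f := fun y1 y2 => (G p y1 * F y2) X) hp).apply_eq a y d.one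
  simpa [hF, map_s] using this

lemma exists_conv2 (g : P →ₗ[k] L →ₗ[k] L →ₗ[k] B)
    (h1 : ∀ p a x y, g p (d.mul (d.s a) x) y = a * g p x y)
    (h2 : ∀ p a x y, g p (d.mul (d.t a) x) y = g p x y * a) :
    ∃ G : P →ₗ[k] L →ₗ[k] Conv h B, ∀ p x y, G p y x = g p x y := by
  refine ⟨LinearMap.mk₂ k (fun p y => (Conv.mk (h := h) (A := B) ((g p).flip y)
    (fun b x => h1 p b x y) (fun b x => h2 p b x y) : Conv h B))
    ?_ ?_ ?_ ?_, fun p x y => rfl⟩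
  · intro p p' y; ext x; exact congrArg (· y) (congrArg (· x) (map_add g p p'))
  · intro c p y; ext x; exact congrArg (· y) (congrArg (· x) (map_smul g c p))
  · intro p y y'; ext x; exact map_add (g p x) y y'
  · intro c p y; ext x; exact map_smul (g p x) c y

lemma exists_conv {A : Type*} [Ring A] [Algebra k A] [BRing k B A] (G : P →ₗ[k] L →ₗ[k] A)
    (h1 : ∀ p a y, G p (d.mul (d.s a) y) = u k a * G p y)
    (h2 : ∀ p a y, G p (d.mul (d.t a) y) = G p y * u k a) :
    ∃ G' : P →ₗ[k] Conv h A, ∀ p y, G' p y = G p y := by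
  refine ⟨{ toFun := fun p => (Conv.mk (h := h) (G p) (fun b y => h1 p b y) (fun b y => h2 p b y) :
              Conv h A)
            map_add' := ?_
            map_smul' := ?_ }, fun p y => rfl⟩
  · intro p p'; ext y; exact congrArg (· y) (map_add G p p')
  · intro c p; ext y; exact congrArg (· y) (map_smul G c p)

lemma exists_inv_conv2 [Nontrivial B] {F : Conv h (Conv h B)} (hF : F d.one = 1)
    (g : P →ₗ[k] L →ₗ[k] L →ₗ[k] B)
    (H : ∀ X, cou X ≠ 0 → Submodule.span k {p | d.conv2P cop (fun x y => F y x)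
      (fun x y => g p x y) X d.one ≠ 0} = ⊤)
    (H' : ∀ X, cou X ≠ 0 → Submodule.span k {p | d.conv2P cop (fun x y => g p x y)
      (fun x y => F y x) X d.one ≠ 0} = ⊤) :
    ∃ G : P →ₗ[k] Conv h (Conv h B), ∀ p x y, G p y x = g p x y := by
  have h1 : cou d.one ≠ 0 := by rw [h.cou_one]; exact one_ne_zero
  obtain ⟨G, hG⟩ := exists_conv2 (h := h) g (inv_s_left hF g (H _ h1)) (inv_t_left hF g (H' _ h1))
  simp only [← hG] at H H'
  obtain ⟨G', hG'⟩ := exists_conv (h := h) G (inv_s_right hF G H) (inv_t_right hF G H')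
  exact ⟨G', fun p x y => by rw [hG', hG]⟩

lemma exists_inverse₂ [Nontrivial B] {F : Conv h (Conv h B)} (hF : F d.one = 1)
    (g : L →ₗ[k] L →ₗ[k] B)
    (H : ∀ X Y, d.conv2P cop (fun x y => F y x) (fun x y => g x y) X Y = cou (d.mul X Y))
    (H' : ∀ X Y, d.conv2P cop (fun x y => g x y) (fun x y => F y x) X Y = cou (d.mul X Y)) :
    ∃ G : Conv h (Conv h B), (∀ x y, G y x = g x y) ∧ F * G = 1 ∧ G * F = 1 := by
  have hk : ∀ S : Set k, (1 : k) ∈ S → Submodule.span k S = ⊤ := fun S hS =>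
    Submodule.eq_top_iff'.2 fun c => by
      simpa using Submodule.smul_mem _ c (Submodule.subset_span hS)
  obtain ⟨G, hG⟩ := exists_inv_conv2 hF (LinearMap.toSpanSingleton k _ g)
    (fun X hX => hk _ (by simpa [H, h.mul_one] using hX))
    (fun X hX => hk _ (by simpa [H', h.mul_one] using hX))
  have hG1 : ∀ x y, G 1 y x = g x y := fun x y => by simp [hG]
  simp only [← hG1] at H H'
  refine ⟨G 1, hG1, ?_, ?_⟩
  · ext Y X
    refine Eq.trans ?_ ((H X Y).trans (h.cou_mul_s X Y).symm)
    exact mul_apply₂ (LinearMap.id (R := k) (M := B)) _ _ X Y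
  · ext Y X
    refine Eq.trans ?_ ((H' X Y).trans (h.cou_mul_s X Y).symm)
    exact mul_apply₂ (LinearMap.id (R := k) (M := B)) _ _ X Y

lemma one_apply₃ (X Y Z : L) :
    (1 : Conv h (Conv h (Conv h B))) Z Y X = cou (d.mul X (d.mul Y Z)) := by
  rw [← h.cou_mul_s, ← h.cou_mul_s Y]
  rfl

lemma eq_zero_of_cou [Nontrivial B] {A : Type*} [Ring A] [Algebra k A] [BRing k B A]
    {E : Conv h (Conv h A)}
    (H : ∀ X Y, cou (d.mul X Y) ≠ 0 → E Y X = 0) : E = 0 := by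
  ext Y X
  refine LinearMap.congr_fun (f := lin (E Y)) (g := 0)
    (LinearMap.ext_on h.span_cou_ne_zero fun X hX => ?_) X
  refine LinearMap.congr_fun (f := ev X ∘ₗ E.lin) (g := 0) (LinearMap.ext_on
    (span_eq_top_of_ne_zero (cou ∘ₗ d.mul X) (m₀ := d.one) (S := {Y | cou (d.mul X Y) ≠ 0})
      (by simpa [h.mul_one] using hX) fun Y hY => hY) fun Y hY => ?_) Y
  exact H X Y hY

lemma exists_rotate {k L B : Type*} [Field k] [AddCommGroup L] [Module k L] [AddCommGroup B]
    [Module k B] (g : L →ₗ[k] L →ₗ[k] L →ₗ[k] B) :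
    ∃ g' : L →ₗ[k] L →ₗ[k] L →ₗ[k] B, ∀ z x y, g' z x y = g x y z :=
  let l : (L →ₗ[k] L →ₗ[k] B) ≃ₗ[k] L →ₗ[k] L →ₗ[k] B := LinearMap.lflip
  ⟨(l.toLinearMap ∘ₗ g).flip, fun _ _ _ => rfl⟩

lemma exists_inverse₃ [Nontrivial B] {F : Conv h (Conv h (Conv h B))} (hF : F d.one d.one = 1)
    (g : L →ₗ[k] L →ₗ[k] L →ₗ[k] B)
    (H : ∀ X Y Z, d.conv3P cop (fun x y z => F z y x) (fun x y z => g x y z) X Y Z =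
      cou (d.mul X (d.mul Y Z)))
    (H' : ∀ X Y Z, d.conv3P cop (fun x y z => g x y z) (fun x y z => F z y x) X Y Z =
      cou (d.mul X (d.mul Y Z))) :
    ∃ G : Conv h (Conv h (Conv h B)), (∀ x y z, G z y x = g x y z) ∧ F * G = 1 ∧ G * F = 1 := by
  obtain ⟨g', hg'⟩ := exists_rotate g
  obtain ⟨G, hG⟩ := exists_inv_conv2 (F := F d.one) hF g'
    (fun X hX => span_lift2_eq_top (f := fun z1 z2 => d.conv2P cop (fun x y => F z1 y x)
      (fun x y => g' z2 x y) X d.one) h.cop_one (by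
        simp only [hg']
        refine (H X d.one d.one).trans_ne ?_
        rwa [h.mul_one, h.mul_one]))
    (fun X hX => span_lift2_eq_top' (f := fun z1 z2 => d.conv2P cop (fun x y => g' z1 x y)
      (fun x y => F z2 y x) X d.one) h.cop_one (by
        simp only [hg']
        refine (H' X d.one d.one).trans_ne ?_
        rwa [h.mul_one, h.mul_one]))
  have hG1 : ∀ x y z, g x y z = G z y x := fun x y z => ((hG z x y).trans (hg' z x y)).symm
  simp only [hG1] at H H'
  have E : ∀ X Y Z, d.lift2 (fun z1 z2 => (F z1 * G z2) Y X) (cop Z) =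
      cou (d.mul X (d.mul Y Z)) := fun X Y Z => by
    refine Eq.trans ?_ (H X Y Z)
    unfold conv3P
    congr 2
    ext z1 z2
    exact mul_apply₂ (LinearMap.id (R := k) (M := B)) _ _ X Y
  have E' : ∀ X Y Z, d.lift2 (fun z1 z2 => (G z1 * F z2) Y X) (cop Z) =
      cou (d.mul X (d.mul Y Z)) := fun X Y Z => by
    refine Eq.trans ?_ (H' X Y Z)
    unfold conv3P
    congr 2
    ext z1 z2
    exact mul_apply₂ (LinearMap.id (R := k) (M := B)) _ _ X Y
  have bE : ∀ X Y, cou (d.mul X Y) ≠ 0 → d.Bal fun z1 z2 => (F z1 * G z2) Y X := fun X Y hXY =>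
    bal_of_lift2_ne_zero (z := cop d.one) (by rwa [E, h.mul_one])
  have bE' : ∀ X Y, cou (d.mul X Y) ≠ 0 → d.Bal fun z1 z2 => (G z1 * F z2) Y X := fun X Y hXY =>
    bal_of_lift2_ne_zero (z := cop d.one) (by rwa [E', h.mul_one])
  have one2 : ∀ X Y, (1 : Conv h (Conv h B)) Y X = cou (d.mul X Y) := fun X Y => by
    rw [← h.cou_mul_s]; rfl
  have i1 : F d.one * G d.one = 1 := by
    rw [← sub_eq_zero]
    refine eq_zero_of_cou fun X Y hXY => ?_
    have := E X Y d.one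
    rw [h.cop_one, (bE X Y hXY).lift2_mk2, h.mul_one, ← one2] at this
    exact sub_eq_zero.2 this
  have i2 : G d.one * F d.one = 1 := by
    rw [← sub_eq_zero]
    refine eq_zero_of_cou fun X Y hXY => ?_
    have := E' X Y d.one
    rw [h.cop_one, (bE' X Y hXY).lift2_mk2, h.mul_one, ← one2] at this
    exact sub_eq_zero.2 this
  obtain ⟨G', hG'⟩ := exists_conv (h := h) (LinearMap.toSpanSingleton k _ G)
    (fun p a z => by
      have : F d.one * u k a * G z - F d.one * G (d.mul (d.s a) z) = 0 :=
        eq_zero_of_cou fun X Y hXY => by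
          have := (bE X Y hXY).apply_eq a d.one z
          rw [map_t] at this
          exact sub_eq_zero.2 this
      have := congrArg (G d.one * ·) (sub_eq_zero.1 this)
      simp only [← mul_assoc, i2, _root_.one_mul] at this
      simp [← this])
    (fun p a z => by
      have : G (d.mul (d.t a) z) * F d.one - G z * (u k a * F d.one) = 0 :=
        eq_zero_of_cou fun X Y hXY => by
          have := (bE' X Y hXY).apply_eq a z d.one
          rw [map_s] at this
          exact sub_eq_zero.2 this
      have := congrArg (· * G d.one) (sub_eq_zero.1 this)
      simp only [mul_assoc, i1, _root_.mul_one] at this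
      simp [this])
  have hG2 : ∀ z, G' 1 z = G z := fun z => by simp [hG']
  refine ⟨G' 1, fun x y z => by rw [hG2, hG1], ?_, ?_⟩
  · ext Z Y X
    rw [one_apply₃, ← E X Y Z]
    simp only [← hG2]
    exact map_mul_apply (ev (h := h) (A := B) X ∘ₗ ev Y) F (G' 1) Z
  · ext Z Y X
    rw [one_apply₃, ← E' X Y Z]
    simp only [← hG2]
    exact map_mul_apply (ev (h := h) (A := B) X ∘ₗ ev Y) (G' 1) F Z

end Inverse

end CqST

namespace CqST

variable {k} {B L : Type*} [Ring B] [Algebra k B] [AddCommGroup L] [Module k L]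
variable {d : CqST k B L} {cop : L →ₗ[k] d.T2} {cou : L →ₗ[k] B}

open Conv

section Bridge

variable {h : Good d cop cou}

lemma exists_cochain₂ (f : L →ₗ[k] L →ₗ[k] B)
    (f1 : ∀ b X Y, f (d.mul (d.s b) X) Y = b * f X Y)
    (f2 : ∀ b X Y, f (d.mul (d.t b) X) Y = f X Y * b)
    (f3 : ∀ b X Y, f (d.mul X (d.s b)) Y = f X (d.mul (d.s b) Y))
    (f4 : ∀ b X Y, f (d.mul X (d.t b)) Y = f X (d.mul (d.t b) Y)) :
    ∃ F : Conv h (Conv h B), ∀ X Y, F Y X = f X Y := by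
  obtain ⟨G, hG⟩ := exists_conv2 (h := h) (LinearMap.toSpanSingleton k _ f)
    (fun p a x y => by simp [f1]) (fun p a x y => by simp [f2])
  have hG1 : ∀ x y, G 1 y x = f x y := fun x y => by simp [hG]
  refine ⟨Conv.mk (h := h) (G 1) (fun b y => ?_) (fun b y => ?_), hG1⟩
  · ext X
    rw [u_mul, hG1, hG1, f3]
  · ext X
    rw [mul_u, hG1, hG1, f4]

lemma exists_cochain₃ (f : L →ₗ[k] L →ₗ[k] L →ₗ[k] B)
    (f1 : ∀ b X Y Z, f (d.mul (d.s b) X) Y Z = b * f X Y Z)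
    (f2 : ∀ b X Y Z, f (d.mul (d.t b) X) Y Z = f X Y Z * b)
    (f3 : ∀ b X Y Z, f (d.mul X (d.s b)) Y Z = f X (d.mul (d.s b) Y) Z)
    (f4 : ∀ b X Y Z, f (d.mul X (d.t b)) Y Z = f X (d.mul (d.t b) Y) Z)
    (f5 : ∀ b X Y Z, f X (d.mul Y (d.s b)) Z = f X Y (d.mul (d.s b) Z))
    (f6 : ∀ b X Y Z, f X (d.mul Y (d.t b)) Z = f X Y (d.mul (d.t b) Z)) :
    ∃ F : Conv h (Conv h (Conv h B)), ∀ X Y Z, F Z Y X = f X Y Z := by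
  obtain ⟨f', hf'⟩ := exists_rotate f
  obtain ⟨G, hG⟩ := exists_conv2 (h := h) f'
    (fun p a x y => by simp only [hf', f1]) (fun p a x y => by simp only [hf', f2])
  obtain ⟨G', hG'⟩ := exists_conv (h := h) G
    (fun p a y => by ext X; simp only [u_mul, hG, hf', f3])
    (fun p a y => by ext X; simp only [mul_u, hG, hf', f4])
  have e : ∀ X Y Z, G' Z Y X = f X Y Z := fun X Y Z => by rw [hG', hG, hf']
  refine ⟨Conv.mk (h := h) G' (fun b z => ?_) (fun b z => ?_), e⟩
  · ext Y X
    rw [u_mul, e, e, f5]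
  · ext Y X
    rw [mul_u, e, e, f6]

lemma genL_exL₂ (F : Conv h (Conv h B)) (w : L → L → L) :
    letI := h.genRing
    ∀ (G : Conv h (Conv h (GenRing d))), (∀ X Y, G Y X = genL h (w X Y)) → ∀ X Y,
      genL h (exL d ((emb2 h (GenRing d) F * G) Y X)) = (emb2 h (GenRing d) F * G) Y X := by
  let := h.genRing
  intro G hG X Y
  refine (mul_apply₂ ((genL h).lin ∘ₗ exL d) (emb2 h (GenRing d) F) G X Y).trans
    (Eq.trans ?_ (mul_apply₂ (LinearMap.id (R := k) (M := GenRing d)) _ G X Y).symm)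
  simp only [LinearMap.comp_apply, lin_apply, emb2_apply, hG, ← map_s, exL_genL,
    LinearMap.id_apply]

lemma genL_exL₃ (F : Conv h (Conv h (Conv h B))) (w : L → L → L → L) :
    letI := h.genRing
    ∀ (G : Conv h (Conv h (Conv h (GenRing d)))), (∀ X Y Z, G Z Y X = genL h (w X Y Z)) →
      ∀ X Y Z, genL h (exL d ((emb3 h (GenRing d) F * G) Z Y X)) =
        (emb3 h (GenRing d) F * G) Z Y X := by
  let := h.genRing
  intro G hG X Y Z
  refine (mul_apply₃ ((genL h).lin ∘ₗ exL d) (emb3 h (GenRing d) F) G X Y Z).trans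
    (Eq.trans ?_ (mul_apply₃ (LinearMap.id (R := k) (M := GenRing d)) _ G X Y Z).symm)
  simp only [LinearMap.comp_apply, lin_apply, emb3_apply, hG, ← map_s, exL_genL,
    LinearMap.id_apply]

lemma genL_exL₃' (F : Conv h (Conv h (Conv h B))) (w : L → L → L → L) :
    letI := h.genRing
    ∀ (G : Conv h (Conv h (Conv h (GenRing d)))), (∀ X Y Z, G Z Y X = genL h (w X Y Z)) →
      ∀ X Y Z, genL h (exL d ((G * emb3 h (GenRing d) F) Z Y X)) =
        (G * emb3 h (GenRing d) F) Z Y X := by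
  let := h.genRing
  intro G hG X Y Z
  refine (mul_apply₃ ((genL h).lin ∘ₗ exL d) G (emb3 h (GenRing d) F) X Y Z).trans
    (Eq.trans ?_ (mul_apply₃ (LinearMap.id (R := k) (M := GenRing d)) G _ X Y Z).symm)
  simp only [LinearMap.comp_apply, lin_apply, emb3_apply, hG, ← map_t, exL_genL,
    LinearMap.id_apply]

/-- Associativity of the product up to a 3-cochain. -/
def QuasiAssoc (F : Conv h (Conv h (Conv h B))) : Prop := ∀ X Y Z,
    d.lift2 (fun z1 z2 => d.lift2 (fun y1 y2 => d.lift2 (fun x1 x2 =>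
      d.mul (d.s (F z1 y1 x1)) (d.mul (d.mul x2 y2) z2)) (cop X)) (cop Y)) (cop Z) =
    d.lift2 (fun z1 z2 => d.lift2 (fun y1 y2 => d.lift2 (fun x1 x2 =>
      d.mul (d.t (F z2 y2 x2)) (d.mul x1 (d.mul y1 z1))) (cop X)) (cop Y)) (cop Z)

lemma QuasiAssoc.mul_mul_s {F : Conv h (Conv h (Conv h B))} (hF : QuasiAssoc F)
    (hF1 : F d.one d.one = 1) {θ : Conv h (Conv h B)} (hθ : θ * F d.one = 1) (a : B) (X Y : L) :
    d.mul (d.mul X Y) (d.s a) = d.mul X (d.mul Y (d.s a)) := by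
  let := h.genRing
  have rhs : ∀ X Y, d.lift2 (fun z1 z2 => d.lift2 (fun y1 y2 => d.lift2 (fun x1 x2 =>
      d.mul (d.t (F z2 y2 x2)) (d.mul x1 (d.mul y1 z1))) (cop X)) (cop Y)) (cop d.one) =
      exL d ((mu (genL h) * emb2 h (GenRing d) (F d.one)) Y X) := fun X Y => by
    have e := mul_apply₃ (exL d) (mu (mu (genL h))) (emb3 h (GenRing d) F) X Y d.one
    simp only [mu_apply, emb3_apply, ← map_t, exL_genL] at e
    have e1 : mu (mu (genL h)) d.one = mu (genL h) := by
      ext1 Y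
      ext1 X
      simp only [mu_apply, h.mul_one]
    rw [← e, mul_apply_one, e1]
    rfl
  have lhs : ∀ z1 z2 X Y, d.lift2 (fun y1 y2 => d.lift2 (fun x1 x2 =>
      d.mul (d.s (F z1 y1 x1)) (d.mul (d.mul x2 y2) z2)) (cop X)) (cop Y) =
      exL d ((emb2 h (GenRing d) (F z1) * mu (mu (genL h) z2)) Y X) := fun z1 z2 X Y => by
    have e := mul_apply₂ (exL d) (emb2 h (GenRing d) (F z1)) (mu (mu (genL h) z2)) X Y
    simp only [mu_apply, emb2_apply, ← map_s, exL_genL] at e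
    exact e.symm
  have mu1 : mu (genL h) d.one = genL h := by
    ext1 X
    simp [h.mul_one]
  have key : ∀ X Y, exL d ((emb2 h (GenRing d) (F d.one) * (u k a * mu (genL h))) Y X) =
      exL d ((emb2 h (GenRing d) (F d.one) * mu ((u k a : Conv h (GenRing d)) * genL h)) Y X) := fun X Y => by
    by_cases hX : X = 0
    · simp [hX]
    refine LinearMap.congr_fun
      (f := exL d ∘ₗ ev (h := h) (A := GenRing d) X ∘ₗ
        (emb2 h (GenRing d) (F d.one) * (u k a * mu (genL h))).lin)
      (g := exL d ∘ₗ ev (h := h) (A := GenRing d) X ∘ₗ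
        (emb2 h (GenRing d) (F d.one) * mu ((u k a : Conv h (GenRing d)) * genL h)).lin)
      (LinearMap.ext_on (span_eq_top_of_ne_zero
        (exL d ∘ₗ ev (h := h) (A := GenRing d) X ∘ₗ (mu (genL h) * emb2 h (GenRing d) (F d.one)).lin)
        (m₀ := d.one)
        (S := {Y | exL d ((mu (genL h) * emb2 h (GenRing d) (F d.one)) Y X) ≠ 0}) ?_ fun Y hY => hY)
        fun Y hY => ?_) Y
    · change exL d ((mu (genL h) * emb2 h (GenRing d) (F d.one)) d.one X) ≠ 0
      rw [mul_apply_one, mu1]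
      have : emb2 h (GenRing d) (F d.one) d.one = 1 := by
        change mapC h (u k) (fun _ => rfl) (F d.one d.one) = 1
        rw [hF1, _root_.map_one]
      rwa [this, _root_.mul_one, exL_genL]
    · have hb := bal_of_lift2_ne_zero ((hF X Y d.one).trans_ne ((rhs X Y).trans_ne hY))
      have := (lhs _ _ X Y).symm.trans ((hb.apply_eq a d.one d.one).trans (lhs _ _ X Y))
      rw [map_t, map_s, _root_.map_mul, mu1] at this
      change exL d ((emb2 h (GenRing d) (F d.one) * (u k a * mu (genL h))) Y X) =
        exL d ((emb2 h (GenRing d) (F d.one) * mu ((u k a : Conv h (GenRing d)) * genL h)) Y X)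
      rw [← mul_assoc]
      refine Eq.trans ?_ this
      rfl
  have e : emb2 h (GenRing d) (F d.one) * (u k a * mu (genL h)) =
      emb2 h (GenRing d) (F d.one) * mu ((u k a : Conv h (GenRing d)) * genL h) := by
    ext1 Y
    ext1 X
    rw [← genL_exL₂ (F d.one) (fun X Y => d.mul X (d.mul Y (d.s a))) (u k a * mu (genL h))
      (fun X Y => by rw [u_mul, mu_apply]), key,
      genL_exL₂ (F d.one) (fun X Y => d.mul (d.mul X Y) (d.s a))
        (mu ((u k a : Conv h (GenRing d)) * genL h))
      (fun X Y => by rw [mu_apply, u_mul])]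
  have e' := congrArg (emb2 h (GenRing d) θ * ·) e
  simp only [← mul_assoc, ← _root_.map_mul, hθ, _root_.map_one, _root_.one_mul] at e'
  have e'' := DFunLike.congr_fun (DFunLike.congr_fun e' Y) X
  rw [u_mul, mu_apply, mu_apply, u_mul] at e''
  exact (genL_injective h e'').symm

lemma QuasiAssoc.assoc_genL {F : Conv h (Conv h (Conv h B))} (hF : QuasiAssoc F)
    (hR : ∀ a X Y, cou (d.mul (d.mul X Y) (d.s a)) = cou (d.mul X (d.mul Y (d.s a)))) :
    letI := h.genRing
    emb3 h (GenRing d) F * mapC h mu (mu_u hR) (mu (genL h)) =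
      mu (mu (genL h)) * emb3 h (GenRing d) F := by
  let := h.genRing
  ext1 Z
  ext1 Y
  ext1 X
  rw [← genL_exL₃ F (fun X Y Z => d.mul (d.mul X Y) Z) (mapC h mu (mu_u hR) (mu (genL h)))
    (fun X Y Z => rfl), ← genL_exL₃' F (fun X Y Z => d.mul X (d.mul Y Z)) (mu (mu (genL h)))
    (fun X Y Z => rfl)]
  congr 1
  refine (mul_apply₃ (exL d) (emb3 h _ F) _ X Y Z).trans (Eq.trans ?_
    ((hF X Y Z).trans (Eq.trans ?_ (mul_apply₃ (exL d) _ (emb3 h _ F) X Y Z).symm)))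
  · simp only [mapC_apply, mu_apply, emb3_apply, ← map_s, exL_genL]
  · simp only [mu_apply, emb3_apply, ← map_t, exL_genL]

lemma pentagon_of_apply {F : Conv h (Conv h (Conv h B))} (hF : Cent k B F)
    (hR : ∀ a X Y, cou (d.mul (d.mul X Y) (d.s a)) = cou (d.mul X (d.mul Y (d.s a))))
    (H : ∀ X Y Z W : L,
      d.lift2 (fun w1 w2 => d.lift2 (fun z1 z2 => d.lift2 (fun y1 y2 => d.lift2 (fun x1 x2 =>
        F (d.mul z1 w1) y1 x1 * F w2 z2 (d.mul x2 y2)) (cop X)) (cop Y)) (cop Z)) (cop W) =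
      d.lift2 (fun w1 w2 => d.lift2 (fun z1 z23 => d.lift2 (fun z2 z3 =>
        d.lift2 (fun y1 y23 => d.lift2 (fun y2 y3 => d.lift2 (fun x1 x2 =>
          F w2 (d.mul (d.s (F w1 z1 y1)) (d.mul y2 z2)) x1 * F z3 y3 x2)
          (cop X)) (cop y23)) (cop Y)) (cop z23)) (cop Z)) (cop W)) :
    mu F * mapC h (mapC h mu (mu_u hR)) (mapC_u _ _) F =
      emb3 h (Conv h B) F * (mapC h mu (mu_u hR) F * iota h F hF) := by
  ext W Z Y X
  refine Eq.trans ?_ ((H X Y Z W).trans (Eq.symm ?_))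
  · exact mul_apply₄ (LinearMap.id (R := k) (M := B)) (mu F)
      (mapC h (mapC h mu (mu_u hR)) (mapC_u _ _) F) X Y Z W
  · refine (map_mul_apply (ev (h := h) (A := B) X ∘ₗ ev (h := h) Y ∘ₗ ev (h := h) Z) _ _ W).trans ?_
    congr 2
    ext w1 w2
    rw [mul_iota]
    refine (mul_mul_apply (ev (h := h) (A := B) X ∘ₗ ev (h := h) Y) (emb3 h (Conv h B) F w1)
      (mapC h mu (mu_u hR) F w2) F Z).trans ?_
    congr 2
    ext z1 z23
    congr 2
    ext z2 z3
    refine (mul_mul_apply (ev (h := h) (A := B) X) (emb3 h (Conv h B) F w1 z1)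
      (mapC h mu (mu_u hR) F w2 z2) (F z3) Y).trans ?_
    congr 2
    ext y1 y23
    congr 2
    ext y2 y3
    have e : emb3 h (Conv h B) F w1 z1 y1 * mapC h mu (mu_u hR) F w2 z2 y2 =
        F w2 (d.mul (d.s (F w1 z1 y1)) (d.mul y2 z2)) := by
      rw [map_s]
      rfl
    rw [← mul_assoc, e]
    exact map_mul_apply (LinearMap.id (R := k) (M := B)) _ _ X

end Bridge

end CqST

namespace CqST

variable {k} {B L : Type*} [Ring B] [Algebra k B] [AddCommGroup L] [Module k L]
variable {d : CqST k B L} {cop : L →ₗ[k] d.T2} {cou : L →ₗ[k] B}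

open Conv

lemma isCoquasi_of_subsingleton [Subsingleton B] [Subsingleton L] (p : L → L → L)
    (Φ Φi : L → L → L → B) : d.IsCoquasi p cop cou Φ Φi := by
  have : Subsingleton (L ⊗[k] L) := inferInstance
  have : Subsingleton (L ⊗[k] (L ⊗[k] L)) := inferInstance
  have : Subsingleton d.T2 := Quotient.instSubsingletonQuotient _
  have : Subsingleton d.T3 := Quotient.instSubsingletonQuotient _
  refine ⟨⟨0, fun _ _ => Subsingleton.elim _ _⟩, ?_, ?_, ?_, ?_, ?_, ?_, ?_, ?_, ?_, ?_, ?_, ?_, ?_,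
    ?_, ?_, ?_, ?_, ?_, ?_, ⟨0, fun _ _ _ => Subsingleton.elim _ _⟩, ?_, ?_, ?_, ?_, ?_, ?_, ?_,
    ⟨0, fun _ _ _ => Subsingleton.elim _ _⟩, ?_, ?_⟩
  all_goals
    intros
    first
    | exact Subsingleton.elim _ _
    | exact ⟨Subsingleton.elim _ _, Subsingleton.elim _ _⟩

lemma exists_twist {h : Good d cop cou} [Nontrivial B]
    (hR : ∀ a X Y, cou (d.mul (d.mul X Y) (d.s a)) = cou (d.mul X (d.mul Y (d.s a))))
    {Sg Sgi : L → L → B}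
    (hSbil : ∃ Sg' : L →ₗ[k] L →ₗ[k] B, ∀ X Y, Sg' X Y = Sg X Y)
    (hSibil : ∃ Sgi' : L →ₗ[k] L →ₗ[k] B, ∀ X Y, Sgi' X Y = Sgi X Y)
    (hSnorm : ∀ X : L, Sg d.one X = cou X ∧ Sg X d.one = cou X)
    (hSbimod : ∀ (b c : B) (X Y : L),
      Sg (d.mul (d.s b) (d.mul (d.t c) X)) Y = b * Sg X Y * c)
    (hSbal : ∀ (b c : B) (X Y : L),
      Sg (d.mul (d.mul X (d.s b)) (d.t c)) Y = Sg X (d.mul (d.s b) (d.mul (d.t c) Y)))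
    (hSst : ∀ (b : B) (X Y : L), Sg X (d.mul Y (d.t b)) = Sg X (d.mul Y (d.s b)))
    (hSinv1 : ∀ X Y : L, d.conv2P cop Sg Sgi X Y = cou (d.mul X Y))
    (hSinv2 : ∀ X Y : L, d.conv2P cop Sgi Sg X Y = cou (d.mul X Y)) :
    ∃ T : Twist h, (∀ X Y, T.S Y X = Sg X Y) ∧ ∀ X Y, T.Si Y X = Sgi X Y := by
  obtain ⟨g, hg⟩ := hSbil
  obtain ⟨gi, hgi⟩ := hSibil
  obtain rfl : Sg = fun X Y => g X Y := by ext X Y; rw [hg]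
  obtain rfl : Sgi = fun X Y => gi X Y := by ext X Y; rw [hgi]
  obtain ⟨S, hS⟩ := exists_cochain₂ (h := h) g
    (fun b X Y => by simpa [h.t_one, h.one_mul] using hSbimod b 1 X Y)
    (fun b X Y => by simpa [h.s_one, h.one_mul] using hSbimod 1 b X Y)
    (fun b X Y => by simpa [h.t_one, h.one_mul, h.mul_one] using hSbal b 1 X Y)
    (fun b X Y => by simpa [h.s_one, h.one_mul, h.mul_one] using hSbal 1 b X Y)
  have hS1 : S d.one = 1 := by
    ext X
    rw [hS]
    exact (hSnorm X).2
  obtain ⟨Si, hSi, i1, i2⟩ := exists_inverse₂ hS1 gi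
    (fun X Y => by simp only [hS]; exact hSinv1 X Y)
    (fun X Y => by simp only [hS]; exact hSinv2 X Y)
  exact ⟨{
    hR := hR
    S := S
    Si := Si
    cent := (cent_iff S).2 fun b Y => by
      ext X
      rw [hS, hS]
      exact (hSst b X Y).symm
    inv := i1
    inv' := i2
    one_right := hS1
    one_left := by
      ext Y
      exact (hS d.one Y).trans (hSnorm Y).1 }, hS, hSi⟩

lemma IsCoquasi.weak {Φ Φi : L → L → L → B}
    (H : d.IsCoquasi (fun X Y => d.mul X Y) cop cou Φ Φi) : Weak d cop cou := by
  obtain ⟨-, h1, h2, h3, h4, h5, -, h7, h8, h9, h10, h11, h12, h13, h14, h15, h16, h17, h18, h19,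
    -⟩ := H
  exact ⟨fun X => (h1 X).1, fun X => (h1 X).2, h2, h3, h4, h5, h7, h8, h9, h10, h11, h12, h13, h14,
    h15, h16, h17, h18, h19⟩

lemma exists_cocycle {h : Good d cop cou} [Nontrivial B] {Φ Φi : L → L → L → B}
    (H : d.IsCoquasi (fun X Y => d.mul X Y) cop cou Φ Φi) :
    ∃ (hR : ∀ a X Y, cou (d.mul (d.mul X Y) (d.s a)) = cou (d.mul X (d.mul Y (d.s a))))
      (C : Cocycle h hR), ∀ X Y Z, C.Φ Z Y X = Φ X Y Z := by
  obtain ⟨-, -, -, -, -, -, -, -, -, -, -, -, -, -, -, -, -, -, -, -, ⟨f, hf⟩, f1, f2, f3, f4, f5,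
    f6, f7, ⟨fi, hfi⟩, i1, i2⟩ := H
  obtain rfl : Φ = fun X Y Z => f X Y Z := by ext X Y Z; rw [hf]
  obtain rfl : Φi = fun X Y Z => fi X Y Z := by ext X Y Z; rw [hfi]
  beta_reduce at f1 f2 f3 f4 f5 f6 f7
  obtain ⟨F, hF⟩ := exists_cochain₃ (h := h) f
    (fun b X Y Z => by simpa [h.t_one, h.one_mul] using f1 b 1 X Y Z)
    (fun b X Y Z => by simpa [h.s_one, h.one_mul] using f1 1 b X Y Z)
    (fun b X Y Z => by simpa [h.t_one, h.one_mul, h.mul_one] using f2 b 1 X Y Z)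
    (fun b X Y Z => by simpa [h.s_one, h.one_mul, h.mul_one] using f2 1 b X Y Z)
    (fun b X Y Z => by simpa [h.t_one, h.one_mul, h.mul_one] using f3 b 1 X Y Z)
    (fun b X Y Z => by simpa [h.s_one, h.one_mul, h.mul_one] using f3 1 b X Y Z)
  simp only [← hF] at f4 f5 f6 f7 i1 i2
  have nl : mapC h (mapC h ev1 ev1_u) (mapC_u _ _) F = 1 := by
    ext Z Y
    exact (f4 Y Z).1.trans (h.cou_mul_s Y Z).symm
  have nm : mapC h ev1 ev1_u F = 1 := by
    ext Z X
    exact (f4 X Z).2.trans (h.cou_mul_s X Z).symm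
  have h1 : F d.one d.one = 1 := by
    ext X
    exact (f4 X d.one).2.trans (by rw [h.mul_one]; rfl)
  obtain ⟨Fi, -, j1, j2⟩ := exists_inverse₃ h1 fi i1 i2
  have hq : QuasiAssoc F := f7
  have hR := fun a X Y => congrArg cou (hq.mul_mul_s h1 (θ := Fi d.one)
    (by rw [← mul_apply_one, j2, ← ev1_apply, _root_.map_one]) a X Y)
  have hc : Cent k B F := (cent_iff F).2 fun b Z => by
    ext Y X
    exact f5 b X Y Z
  exact ⟨hR, ⟨F, Fi, hc, j1, j2, nl, nm, hq.assoc_genL hR, pentagon_of_apply hc hR f6⟩, hF⟩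

end CqST

/-- Let `(L, Φ)` be a left `B`-coquasi-bialgebroid and `Σ` a unital
convolution-invertible element of the `B`-bimodule maps `L ⊗_{B^e} L → B` with
`Σ(X, Y t(b)) = Σ(X, Y s(b))`.  Then the underlying `B`-coring of `L` with the twisted product
`X ·_Σ Y = s(Σ(X₁,Y₁)) t(Σ⁻¹(X₃,Y₃)) X₂Y₂` is again a left `B`-coquasi-bialgebroid `L^Σ`,
with 3-cocycle `Φ^Σ`. -/
theorem coquasi_bialgebroid_cotwist
    {k : Type*} [Field k] {B L : Type*} [Ring B] [Algebra k B] [AddCommGroup L] [Module k L]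
    (d : CqST k B L) (cop : L →ₗ[k] d.T2) (cou : L →ₗ[k] B) (Φ Φi : L → L → L → B)
    (hcq : d.IsCoquasi (fun X Y => d.mul X Y) cop cou Φ Φi)
    (Sg Sgi : L → L → B)
    (hSbil : ∃ Sg' : L →ₗ[k] L →ₗ[k] B, ∀ X Y, Sg' X Y = Sg X Y)
    (hSibil : ∃ Sgi' : L →ₗ[k] L →ₗ[k] B, ∀ X Y, Sgi' X Y = Sgi X Y)
    (hSnorm : ∀ X : L, Sg d.one X = cou X ∧ Sg X d.one = cou X)
    (hSbimod : ∀ (b c : B) (X Y : L),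
      Sg (d.mul (d.s b) (d.mul (d.t c) X)) Y = b * Sg X Y * c)
    (hSbal : ∀ (b c : B) (X Y : L),
      Sg (d.mul (d.mul X (d.s b)) (d.t c)) Y = Sg X (d.mul (d.s b) (d.mul (d.t c) Y)))
    (hSst : ∀ (b : B) (X Y : L), Sg X (d.mul Y (d.t b)) = Sg X (d.mul Y (d.s b)))
    (hSinv1 : ∀ X Y : L, d.conv2P cop Sg Sgi X Y = cou (d.mul X Y))
    (hSinv2 : ∀ X Y : L, d.conv2P cop Sgi Sg X Y = cou (d.mul X Y)) :
    ∃ Φsi : L → L → L → B,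
      d.IsCoquasi (d.prodSigma cop Sg Sgi) cop cou (d.PhiSigma cop Sg Sgi Φ) Φsi := by
  have hw := hcq.weak
  cases subsingleton_or_nontrivial L with
  | inl hL =>
    have : Subsingleton B := subsingleton_of_zero_eq_one <| by
      rw [← hw.cou_one, Subsingleton.elim d.one 0, map_zero]
    exact ⟨fun _ _ _ => 0, CqST.isCoquasi_of_subsingleton _ _ _⟩
  | inr hL =>
    have : Nontrivial B := by
      refine not_subsingleton_iff_nontrivial.1 fun hB => not_subsingleton L ⟨fun X Y => ?_⟩
      have e : d.one = 0 := by rw [← hw.s_one, Subsingleton.elim (1 : B) 0, map_zero]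
      rw [← hw.one_mul X, ← hw.one_mul Y, e, map_zero]
      rfl
    obtain ⟨hR, C, hC⟩ := CqST.exists_cocycle (h := hw.good) hcq
    obtain ⟨T, hS, hSi⟩ := CqST.exists_twist (h := hw.good) hR hSbil hSibil hSnorm hSbimod hSbal
      hSst hSinv1 hSinv2
    obtain rfl : Sg = fun X Y => T.S Y X := by ext X Y; rw [hS]
    obtain rfl : Sgi = fun X Y => T.Si Y X := by ext X Y; rw [hSi]
    obtain rfl : Φ = fun X Y Z => C.Φ Z Y X := by ext X Y Z; rw [hC]
    refine ⟨fun X Y Z => T.PiA C B Z Y X, ?_⟩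
    have e : d.PhiSigma cop (fun X Y => T.S Y X) (fun X Y => T.Si Y X)
        (fun X Y Z => C.Φ Z Y X) = fun X Y Z => T.PA C B Z Y X := by
      ext X Y Z
      exact T.phiSigma_eq C X Y Z
    rw [e]
    exact T.isCoquasi C

end
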